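/- Let l ≥ 3. Let Φ⁺ ⊂ ℕ^l be the set consisting of: α_i + ⋯ + α_j for 1 ≤ i ≤ j ≤ l−1; α_i + ⋯ + α_{l−2} + α_l for 1 ≤ i ≤ l−2, together with α_l; and α_i + ⋯ + α_{j−1} + 2(α_j + ⋯ + α_{l−2}) + α_{l−1} + α_l for 1 ≤ i < j ≤ l−1, where α_s denotes the s-th standard basis vector of ℕ^l (this is the set of the l(l−1) positive roots of type D_l in simple-root coordinates, with the Dynkin diagram a chain α_1–α_2–⋯–α_{l−1} and the node α_l attached to α_{l−2}). Then in ℤ[[q, y_1, …, y_l]]: ∏_{c ∈ Φ⁺} ∏_{n≥1} (1 − q^n y_1^{c_1} ⋯ y_l^{c_l})^{−1} = ∑ over all l-tuples (r_1, …, r_l) of descending sequences of q^{E} · ( ∏_{i=1}^{l} y_i^{|r_i|} ) · ∏_{i=1}^{l} ∏_{j≥1} (q;q)_{r_i^{(j)} − r_i^{(j+1)}}^{−1}, where E = ∑_{i=1}^{l} ∑_{t≥1} (r_i^{(t)})² − ∑_{i=2}^{l−1} ∑_{t≥1} r_{i−1}^{(t)} r_i^{(t)} − ∑_{t≥1} r_{l−2}^{(t)}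 r_l^{(t)}; here E is a nonnegative integer. -/

import Mathlib

open MvPowerSeries

/-- The product topology (coefficientwise convergence) on multivariate formal power series. -/
noncomputable instance (σ R : Type*) [TopologicalSpace R] :
    TopologicalSpace (MvPowerSeries σ R) :=
  inferInstanceAs (TopologicalSpace ((σ →₀ ℕ) → R))

/-- `r : ℕ → ℕ` is a descending sequence (indexed so that `r t = r^{(t+1)}`):
nonincreasing and eventually zero. -/
def IsDescending (r : ℕ → ℕ) : Prop :=
  Antitone r ∧ ∃ N, ∀ t ≥ N, r t = 0

/-- The variable `q` in `ℤ[[q, y₁, …, y_l]]`, realized as `MvPowerSeries (Fin (l+1)) ℤ`. -/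
noncomputable def Q (l : ℕ) : MvPowerSeries (Fin (l + 1)) ℤ := X 0

/-- The variable `yᵢ` (`1 ≤ i ≤ l`) in `ℤ[[q, y₁, …, y_l]]`. -/
noncomputable def Y (l : ℕ) (i : ℕ) : MvPowerSeries (Fin (l + 1)) ℤ :=
  if h : i < l + 1 then X ⟨i, h⟩ else 1

/-- `(q;q)_m = ∏_{u=1}^m (1 - qᵘ)`. -/
noncomputable def qPoch (l : ℕ) (m : ℕ) : MvPowerSeries (Fin (l + 1)) ℤ :=
  ∏ u ∈ Finset.range m, (1 - Q l ^ (u + 1))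

section Descending

open Finset

theorem finprod_nat_eq_zero_mul {M : Type*} [CommMonoid M] (h : ℕ → M)
    (hf : (Function.mulSupport h).Finite) : ∏ᶠ t, h t = h 0 * ∏ᶠ t, h (t + 1) := by
  obtain ⟨N, hN⟩ := hf.bddAbove
  have h1 : Function.mulSupport h ⊆ (range (N + 1) : Finset ℕ) := fun x hx => by
    have := hN hx
    simp; omega
  have h2 : Function.mulSupport (fun t => h (t + 1)) ⊆ (range N : Finset ℕ) := fun x hx => by
    have := hN (show x + 1 ∈ Function.mulSupport h from hx)
    simp; omega
  rw [finprod_eq_prod_of_mulSupport_subset _ h1, finprod_eq_prod_of_mulSupport_subset _ h2,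
    Finset.prod_range_succ', mul_comm]

theorem finsum_nat_eq_zero_add {M : Type*} [AddCommMonoid M] (h : ℕ → M)
    (hf : (Function.support h).Finite) : ∑ᶠ t, h t = h 0 + ∑ᶠ t, h (t + 1) := by
  obtain ⟨N, hN⟩ := hf.bddAbove
  have h1 : Function.support h ⊆ (range (N + 1) : Finset ℕ) := fun x hx => by
    have := hN hx
    simp; omega
  have h2 : Function.support (fun t => h (t + 1)) ⊆ (range N : Finset ℕ) := fun x hx => by
    have := hN (show x + 1 ∈ Function.support h from hx)
    simp; omega
  rw [finsum_eq_sum_of_support_subset _ h1, finsum_eq_sum_of_support_subset _ h2,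
    Finset.sum_range_succ', add_comm]

namespace IsDescending

theorem zero : IsDescending 0 := ⟨fun _ _ _ => le_rfl, 0, fun _ _ => rfl⟩

theorem finite_support {r : ℕ → ℕ} (h : IsDescending r) : (Function.support r).Finite := by
  obtain ⟨N, hN⟩ := h.2
  refine (Set.finite_lt_nat N).subset fun x hx => ?_
  by_contra hc
  exact hx (hN x (not_lt.mp hc))

theorem tail {r : ℕ → ℕ} (h : IsDescending r) : IsDescending (fun t => r (t + 1)) := by
  refine ⟨fun a b hab => h.1 (by omega), ?_⟩
  obtain ⟨N, hN⟩ := h.2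
  exact ⟨N, fun t ht => hN _ (by omega)⟩

theorem finsum_eq {r : ℕ → ℕ} (h : IsDescending r) :
    ∑ᶠ t, r t = r 0 + ∑ᶠ t, r (t + 1) :=
  finsum_nat_eq_zero_add _ h.finite_support

theorem mul_le_finsum {r : ℕ → ℕ} (h : IsDescending r) (t : ℕ) :
    (t + 1) * r t ≤ ∑ᶠ s, r s := by
  induction t generalizing r with
  | zero => rw [h.finsum_eq]; simp
  | succ t ih =>
    have h1 := ih h.tail
    rw [h.finsum_eq]
    have h2 : r (t + 1) ≤ r 0 := h.1 (by omega)
    nlinarith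

theorem le_finsum {r : ℕ → ℕ} (h : IsDescending r) (t : ℕ) : r t ≤ ∑ᶠ s, r s :=
  le_trans (Nat.le_mul_of_pos_left _ (by omega)) (h.mul_le_finsum t)

theorem eq_zero_of_finsum_le {r : ℕ → ℕ} (h : IsDescending r) {t : ℕ} (ht : ∑ᶠ s, r s ≤ t) :
    r t = 0 := by
  by_contra hc
  have h1 := h.mul_le_finsum t
  have h2 : 1 ≤ r t := by omega
  nlinarith

theorem finite_mulSupport {M : Type*} [One M] {r : ℕ → ℕ} (h : IsDescending r) {g : ℕ → M}
    (hg : ∀ t, r t = 0 → g t = 1) : (Function.mulSupport g).Finite :=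
  h.finite_support.subset fun t ht hr => ht (hg t hr)

theorem finite_support_of {M : Type*} [Zero M] {r : ℕ → ℕ} (h : IsDescending r) {g : ℕ → M}
    (hg : ∀ t, r t = 0 → g t = 0) : (Function.support g).Finite :=
  h.finite_support.subset fun t ht hr => ht (hg t hr)

theorem sum_mul {ι : Type*} (s : Finset ι) (a : ι → ℕ) {r : ι → ℕ → ℕ}
    (h : ∀ i ∈ s, IsDescending (r i)) : IsDescending (fun t => ∑ i ∈ s, a i * r i t) := by
  classical
  induction s using Finset.induction_on with
  | empty => exact zero
  | insert i s hi ih =>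
    obtain ⟨h1, N, hN⟩ := ih fun j hj => h j (mem_insert_of_mem hj)
    obtain ⟨h2, M, hM⟩ := h i (mem_insert_self _ _)
    refine ⟨fun x y hxy => ?_, max M N, fun t ht => ?_⟩
    · simp only [sum_insert hi]
      exact add_le_add (Nat.mul_le_mul_left _ (h2 hxy)) (h1 hxy)
    · simp only [sum_insert hi]
      have h3 : ∑ i ∈ s, a i * r i t = 0 := hN t (le_trans (le_max_right _ _) ht)
      rw [hM t (le_trans (le_max_left _ _) ht), h3, mul_zero]

end IsDescending

/-- Prepend a value to a sequence. -/
def consSeq (a : ℕ) (r : ℕ → ℕ) : ℕ → ℕ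
  | 0 => a
  | t + 1 => r t

@[simp] theorem consSeq_zero (a : ℕ) (r : ℕ → ℕ) : consSeq a r 0 = a := rfl

@[simp] theorem consSeq_succ (a : ℕ) (r : ℕ → ℕ) (t : ℕ) : consSeq a r (t + 1) = r t := rfl

theorem IsDescending.cons {a : ℕ} {r : ℕ → ℕ} (h : IsDescending r) (ha : r 0 ≤ a) :
    IsDescending (consSeq a r) := by
  constructor
  · refine antitone_nat_of_succ_le fun n => ?_
    cases n with
    | zero => exact ha
    | succ n => exact h.1 (Nat.le_succ n)
  · obtain ⟨N, hN⟩ := h.2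
    refine ⟨N + 1, fun t ht => ?_⟩
    obtain ⟨s, rfl⟩ : ∃ s, t = s + 1 := ⟨t - 1, by omega⟩
    exact hN s (by omega)

theorem finite_descending (m : ℕ) :
    {r : ℕ → ℕ | IsDescending r ∧ ∑ᶠ t, r t = m}.Finite := by
  have : Set.InjOn (fun (r : ℕ → ℕ) (t : Fin m) => r t)
      {r : ℕ → ℕ | IsDescending r ∧ ∑ᶠ t, r t = m} := by
    rintro r ⟨hr, hm⟩ s ⟨hs, hm'⟩ h
    funext t
    by_cases ht : t < m
    · exact congrFun h ⟨t, ht⟩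
    · rw [hr.eq_zero_of_finsum_le (by omega), hs.eq_zero_of_finsum_le (by omega)]
  refine Set.Finite.of_finite_image (Set.Finite.subset
    (Set.finite_Iic (fun _ : Fin m => m)) ?_) this
  rintro _ ⟨r, ⟨hr, hm⟩, rfl⟩ t
  exact hm ▸ hr.le_finsum t

/-- The descending sequences with sum `m`. -/
noncomputable def descending (m : ℕ) : Finset (ℕ → ℕ) := (finite_descending m).toFinset

@[simp] theorem mem_descending {m : ℕ} {r : ℕ → ℕ} :
    r ∈ descending m ↔ IsDescending r ∧ ∑ᶠ t, r t = m := by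
  simp [descending]

theorem descending_zero : descending 0 = {0} := by
  ext r
  simp only [mem_descending, mem_singleton]
  constructor
  · rintro ⟨h, h0⟩
    funext t
    exact h.eq_zero_of_finsum_le (by omega)
  · rintro rfl
    exact ⟨IsDescending.zero, by simp⟩

/-- Split off the first entry of a descending sequence. -/
theorem sum_descending {M : Type*} [AddCommMonoid M] (m : ℕ) (F : (ℕ → ℕ) → M) :
    ∑ r ∈ descending m, F r =
      ∑ a ∈ range (m + 1), ∑ r ∈ descending (m - a), if r 0 ≤ a then F (consSeq a r) else 0 := by
  simp_rw [← Finset.sum_filter]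
  rw [Finset.sum_sigma']
  refine Finset.sum_bij' (fun r _ => ⟨r 0, fun t => r (t + 1)⟩) (fun p _ => consSeq p.1 p.2)
    ?_ ?_ ?_ ?_ ?_
  · intro r hr
    obtain ⟨h, hm⟩ := mem_descending.mp hr
    have h1 := h.finsum_eq
    have h2 : r 1 ≤ r 0 := h.1 (by omega)
    simp only [mem_sigma, mem_range, mem_filter, mem_descending]
    exact ⟨by omega, ⟨h.tail, by omega⟩, h2⟩
  · rintro ⟨a, r⟩ hp
    simp only [mem_sigma, mem_range, mem_filter, mem_descending] at hp
    obtain ⟨h1, ⟨h2, h3⟩, h4⟩ := hp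
    have h5 := h2.cons h4
    refine mem_descending.mpr ⟨h5, ?_⟩
    rw [h5.finsum_eq]
    simp only [consSeq_zero, consSeq_succ]
    omega
  · intro r _
    funext t
    cases t <;> rfl
  · rintro ⟨a, r⟩ _
    rfl
  · intro r _
    congr 1
    funext t
    cases t <;> rfl

end Descending

namespace PowerSeries

open Finset

variable {K : Type*} [Field K]

/-- The `X`-adically convergent sum `∑ r, X ^ r * φ r`. -/
noncomputable def ysum (φ : ℕ → K⟦X⟧) : K⟦X⟧ :=
  PowerSeries.mk fun m => ∑ r ∈ range (m + 1), coeff (m - r) (φ r)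

theorem coeff_ysum (φ : ℕ → K⟦X⟧) (m : ℕ) :
    coeff m (ysum φ) = ∑ r ∈ range (m + 1), coeff (m - r) (φ r) := coeff_mk _ _

theorem coeff_ysum_eq_coeff_sum (φ : ℕ → K⟦X⟧) {m N : ℕ} (h : m < N) :
    coeff m (ysum φ) = coeff m (∑ r ∈ range N, X ^ r * φ r) := by
  rw [coeff_ysum, map_sum, ← sum_subset (range_mono (show m + 1 ≤ N by omega))]
  · refine sum_congr rfl fun r hr => ?_
    rw [coeff_X_pow_mul', if_pos (by simpa [Nat.lt_succ_iff] using hr)]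
  · intro r _ hr
    rw [coeff_X_pow_mul', if_neg (by simpa [Nat.lt_succ_iff] using hr)]

theorem ysum_add (φ ψ : ℕ → K⟦X⟧) : ysum (fun r => φ r + ψ r) = ysum φ + ysum ψ := by
  ext m
  simp [coeff_ysum, sum_add_distrib]

theorem ysum_sub (φ ψ : ℕ → K⟦X⟧) : ysum (fun r => φ r - ψ r) = ysum φ - ysum ψ := by
  ext m
  simp [coeff_ysum, sum_sub_distrib]

theorem mul_ysum (a : K⟦X⟧) (φ : ℕ → K⟦X⟧) : a * ysum φ = ysum (fun r => a * φ r) := by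
  ext m
  rw [coeff_ysum_eq_coeff_sum _ (Nat.lt_succ_self m)]
  simp_rw [mul_left_comm _ a, ← mul_sum]
  rw [coeff_mul, coeff_mul]
  refine sum_congr rfl fun p hp => ?_
  have := mem_antidiagonal.mp hp
  rw [coeff_ysum_eq_coeff_sum _ (show p.2 < m.succ by omega)]

theorem rescale_ysum (c : K) (φ : ℕ → K⟦X⟧) :
    rescale c (ysum φ) = ysum (fun r => C (c ^ r) * rescale c (φ r)) := by
  ext m
  simp only [coeff_rescale, coeff_ysum, coeff_C_mul, mul_sum]
  refine sum_congr rfl fun r hr => ?_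
  rw [← mul_assoc, ← pow_add, show r + (m - r) = m by have := mem_range.mp hr; omega]

theorem ysum_eq_zero_add (φ : ℕ → K⟦X⟧) : ysum φ = φ 0 + X * ysum (fun r => φ (r + 1)) := by
  ext m
  rw [map_add, coeff_ysum, sum_range_succ', add_comm, Nat.sub_zero]
  cases m with
  | zero => simp
  | succ m => 
    rw [coeff_succ_X_mul, coeff_ysum]
    simp [Nat.add_sub_add_right]

theorem ysum_eq_sum (φ : ℕ → K⟦X⟧) (N : ℕ) (h : ∀ r, N < r → φ r = 0) :
    ysum φ = ∑ r ∈ range (N + 1), X ^ r * φ r := by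
  ext m
  rw [coeff_ysum_eq_coeff_sum φ (show m < m + N + 1 by omega)]
  congr 1
  refine (sum_subset (range_mono (by omega)) fun r _ hr => ?_).symm
  rw [h r (by simpa [Nat.lt_succ_iff] using hr), mul_zero]

theorem rescale_const (c a : K) : rescale c (C a) = C a := by
  ext m
  rw [coeff_rescale, coeff_C]
  split_ifs with h <;> simp [h]

/-- The geometric series `1 / (1 - c X)`. -/
noncomputable def geo (c : K) : K⟦X⟧ := PowerSeries.mk fun n => c ^ n

theorem geo_eq (c : K) : geo c = 1 + C c * X * geo c := by
  ext m
  cases m with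
  | zero => simp [geo]
  | succ m =>
    rw [map_add, mul_assoc, coeff_C_mul, coeff_succ_X_mul]
    simp [geo, coeff_one, pow_succ']

theorem one_sub_mul_geo (c : K) : (1 - C c * X) * geo c = 1 := by
  have := geo_eq c
  linear_combination this

theorem rescale_geo (a c : K) : rescale a (geo c) = geo (a * c) := by
  ext m
  simp [geo, coeff_rescale, mul_pow]

/-- `(q;q)_m` in a field. -/
noncomputable def qp (q : K) (m : ℕ) : K := ∏ u ∈ range m, (1 - q ^ (u + 1))

theorem qp_zero (q : K) : qp q 0 = 1 := by simp [qp]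

theorem qp_succ (q : K) (m : ℕ) : qp q (m + 1) = qp q m * (1 - q ^ (m + 1)) := by
  simp [qp, prod_range_succ]

theorem qp_ne_zero {q : K} (hq : ∀ n, q ^ (n + 1) ≠ 1) (m : ℕ) : qp q m ≠ 0 :=
  prod_ne_zero_iff.mpr fun u _ => sub_ne_zero.mpr (hq u).symm

/-- `1 / (q X; q)_R`. -/
noncomputable def ip (q : K) (R : ℕ) : K⟦X⟧ := ∏ u ∈ range R, geo (q ^ (u + 1))

theorem ip_succ (q : K) (R : ℕ) : ip q (R + 1) = ip q R * geo (q ^ (R + 1)) := by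
  simp [ip, prod_range_succ]

theorem ip_succ_eq_rescale (q : K) (R : ℕ) : ip q (R + 1) = geo q * rescale q (ip q R) := by
  simp only [ip, prod_range_succ', map_prod, rescale_geo, ← pow_succ']
  simp [mul_comm]

theorem ip_succ_eq_add (q : K) (R : ℕ) :
    ip q (R + 1) = ip q R + C (q ^ (R + 1)) * X * ip q (R + 1) := by
  have := geo_eq (q ^ (R + 1))
  rw [ip_succ]
  linear_combination ip q R * this

/-- The finite `q`-Vandermonde sum. -/
theorem sum_vandermonde {q : K} (hq : ∀ n, q ^ (n + 1) ≠ 1) (R : ℕ) :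
    ∑ r ∈ range (R + 1), X ^ r * (C (q ^ (r ^ 2) * (qp q (R - r))⁻¹ * (qp q r)⁻¹) * ip q r)
      = C (qp q R)⁻¹ * ip q R := by
  have hne := qp_ne_zero hq
  induction R with
  | zero => simp [qp_zero]
  | succ R ih =>
    have h1 : (1 - q ^ (R + 1)) ≠ 0 := sub_ne_zero.mpr (hq R).symm
    have key : C (1 - q ^ (R + 1)) * ∑ r ∈ range (R + 1 + 1),
        X ^ r * (C (q ^ (r ^ 2) * (qp q (R + 1 - r))⁻¹ * (qp q r)⁻¹) * ip q r)
        = C (qp q R)⁻¹ * ip q (R + 1) := by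
      have e1 : C (1 - q ^ (R + 1)) * ∑ r ∈ range (R + 1 + 1),
          X ^ r * (C (q ^ (r ^ 2) * (qp q (R + 1 - r))⁻¹ * (qp q r)⁻¹) * ip q r)
          = ∑ r ∈ range (R + 1),
            X ^ r * (C (q ^ (r ^ 2) * (qp q (R - r))⁻¹ * (qp q r)⁻¹) * ip q r)
          + ∑ r ∈ range (R + 1), X ^ (r + 1) *
            (C (q ^ (R - r) * q ^ ((r + 1) ^ 2) * (qp q (R - r))⁻¹ * (qp q r)⁻¹) *
              ip q (r + 1)) := by
        have e2 : ∀ r ∈ range (R + 1 + 1), C (1 - q ^ (R + 1)) *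
            (X ^ r * (C (q ^ (r ^ 2) * (qp q (R + 1 - r))⁻¹ * (qp q r)⁻¹) * ip q r))
            = X ^ r * (C ((1 - q ^ (R + 1 - r)) * q ^ (r ^ 2) * (qp q (R + 1 - r))⁻¹ *
                (qp q r)⁻¹) * ip q r)
              + X ^ r * (C (q ^ (R + 1 - r) * (1 - q ^ r) * q ^ (r ^ 2) * (qp q (R + 1 - r))⁻¹ *
                (qp q r)⁻¹) * ip q r) := by
          intro r hr
          have : q ^ (R + 1) = q ^ (R + 1 - r) * q ^ r := by
            rw [← pow_add, Nat.sub_add_cancel (by simpa [Nat.lt_succ_iff] using hr)]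
          rw [this]
          simp only [map_mul, map_sub, map_one]
          ring
        rw [mul_sum, sum_congr rfl e2, sum_add_distrib]
        congr 1
        · rw [sum_range_succ]
          simp only [Nat.sub_self, pow_zero, sub_self, zero_mul, map_zero, mul_zero, add_zero]
          refine sum_congr rfl fun r hr => ?_
          have hr' : r ≤ R := by simpa [Nat.lt_succ_iff] using hr
          have h2 : (1 - q ^ (R - r + 1)) ≠ 0 := sub_ne_zero.mpr (hq _).symm
          rw [Nat.succ_sub hr', Nat.succ_eq_add_one, qp_succ]
          congr 3
          field_simp [hne]
        · rw [sum_range_succ']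
          simp only [pow_zero, sub_self, zero_mul, map_zero, mul_zero, add_zero]
          refine sum_congr rfl fun r hr => ?_
          have h2 : (1 - q ^ (r + 1)) ≠ 0 := sub_ne_zero.mpr (hq _).symm
          rw [Nat.add_sub_add_right, qp_succ]
          congr 3
          field_simp [hne]
      have e3 : ∑ r ∈ range (R + 1), X ^ (r + 1) *
            (C (q ^ (R - r) * q ^ ((r + 1) ^ 2) * (qp q (R - r))⁻¹ * (qp q r)⁻¹) * ip q (r + 1))
          = C (q ^ (R + 1)) * X * geo q * rescale q (∑ r ∈ range (R + 1),
            X ^ r * (C (q ^ (r ^ 2) * (qp q (R - r))⁻¹ * (qp q r)⁻¹) * ip q r)) := by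
        rw [map_sum, mul_sum]
        refine sum_congr rfl fun r hr => ?_
        have hr' : r ≤ R := by simpa [Nat.lt_succ_iff] using hr
        have : q ^ (R - r) * q ^ ((r + 1) ^ 2) = q ^ (R + 1) * q ^ r * q ^ (r ^ 2) := by
          rw [← pow_add, ← pow_add, ← pow_add]
          congr 1
          zify [hr']
          ring
        rw [this, ip_succ_eq_rescale]
        simp only [map_mul, map_pow, rescale_X]
        simp only [← map_pow, rescale_const]
        simp only [map_pow]
        ring
      rw [e1, e3, ih, map_mul]
      rw [rescale_const]
      have h3 := ip_succ_eq_rescale q R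
      have h4 := ip_succ_eq_add q R
      linear_combination (-C (q ^ (R + 1)) * X * C (qp q R)⁻¹) * h3 - C (qp q R)⁻¹ * h4
    rw [qp_succ, mul_inv, mul_comm (qp q R)⁻¹, map_mul, mul_assoc, ← key, ← mul_assoc, ← map_mul,
      inv_mul_cancel₀ h1, map_one, one_mul]

end PowerSeries

namespace PowerSeries

open Finset

variable {K : Type*} [Field K]

/-- `∏ 1 / (q;q)_{r_t - r_{t+1}}`. -/
noncomputable def stepWeight (q : K) (r : ℕ → ℕ) : K := ∏ᶠ t, (qp q (r t - r (t + 1)))⁻¹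

/-- The generating function, by total size, of descending sequences `r` with weight
`ρ (r 0) * q ^ (∑ (r_t ^ 2 - r_t n_t)) / ∏ (q;q)_{r_t - r_{t+1}}`. -/
noncomputable def chainSum (q : K) (ρ : ℕ → K) (n : ℕ → ℤ) : K⟦X⟧ :=
  PowerSeries.mk fun m => ∑ r ∈ descending m,
    ρ (r 0) * (stepWeight q r * q ^ (∑ᶠ t, ((r t : ℤ) ^ 2 - r t * n t)))

/-- The weight `1 / (q;q)_{a - b}`, zero unless `b ≤ a`. -/
noncomputable def capWeight (q : K) (a b : ℕ) : K := if b ≤ a then (qp q (a - b))⁻¹ else 0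

theorem coeff_chainSum (q : K) (ρ : ℕ → K) (n : ℕ → ℤ) (m : ℕ) :
    coeff m (chainSum q ρ n) = ∑ r ∈ descending m,
      ρ (r 0) * (stepWeight q r * q ^ (∑ᶠ t, ((r t : ℤ) ^ 2 - r t * n t))) := coeff_mk _ _

theorem stepWeight_cons (q : K) {a : ℕ} {r : ℕ → ℕ} (h : IsDescending r) (ha : r 0 ≤ a) :
    stepWeight q (consSeq a r) = (qp q (a - r 0))⁻¹ * stepWeight q r := by
  have h1 := h.cons ha
  unfold stepWeight
  rw [finprod_nat_eq_zero_mul]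
  · simp
  · refine h1.finite_mulSupport fun t ht => ?_
    rw [ht]
    simp [qp]

theorem chainSum_eq_ysum {q : K} (hq0 : q ≠ 0) (ρ : ℕ → K) (n : ℕ → ℤ) :
    chainSum q ρ n = ysum fun a => C (ρ a * q ^ ((a : ℤ) ^ 2 - a * n 0)) *
      chainSum q (capWeight q a) (fun t => n (t + 1)) := by
  ext m
  rw [coeff_ysum, coeff_chainSum, sum_descending]
  refine sum_congr rfl fun a _ => ?_
  rw [coeff_C_mul, coeff_chainSum, mul_sum]
  refine sum_congr rfl fun r hr => ?_
  obtain ⟨hr, _⟩ := mem_descending.mp hr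
  unfold capWeight
  split_ifs with h
  · rw [stepWeight_cons q hr h, finsum_nat_eq_zero_add]
    · simp only [consSeq_zero, consSeq_succ]
      rw [zpow_add₀ hq0]
      ring
    · refine (hr.cons h).finite_support_of fun t ht => ?_
      rw [ht]
      simp
  · simp

theorem coeff_chainSum_capWeight_zero (q : K) (n : ℕ → ℤ) (m : ℕ) :
    coeff m (chainSum q (capWeight q 0) n) = if m = 0 then 1 else 0 := by
  rw [coeff_chainSum]
  split_ifs with h
  · subst h
    simp [descending_zero, capWeight, qp_zero, stepWeight]
  · refine sum_eq_zero fun r hr => ?_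
    obtain ⟨hr, hm⟩ := mem_descending.mp hr
    have : ¬ r 0 ≤ 0 := fun h0 => h <| by
      have hr0 : r = 0 := funext fun t => Nat.le_zero.mp ((hr.1 (Nat.zero_le t)).trans h0)
      rw [← hm, hr0]
      simp
    simp [capWeight, this]

theorem chainSum_capWeight_zero {q : K} (hq0 : q ≠ 0) (hq : ∀ n, q ^ (n + 1) ≠ 1) (R : ℕ) :
    chainSum q (capWeight q R) 0 = C (qp q R)⁻¹ * ip q R := by
  have key : ∀ m R, coeff m (chainSum q (capWeight q R) 0) = coeff m (C (qp q R)⁻¹ * ip q R) := by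
    intro m
    induction m using Nat.strong_induction_on with
    | _ m ih =>
      intro R
      have h1 : C (qp q R)⁻¹ * ip q R = ysum fun a => C (capWeight q R a * q ^ ((a : ℤ) ^ 2)) *
          (C (qp q a)⁻¹ * ip q a) := by
        rw [ysum_eq_sum _ R, ← sum_vandermonde hq R]
        · refine sum_congr rfl fun r hr => ?_
          rw [capWeight, if_pos (by simpa [Nat.lt_succ_iff] using hr), ← mul_assoc (C _) (C _),
            ← map_mul]
          congr 3
          rw [show q ^ ((r : ℤ) ^ 2) = q ^ (r ^ 2) by exact_mod_cast zpow_natCast q (r ^ 2)]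
          ring
        · intro r hr
          simp [capWeight, not_le.mpr hr]
      rw [h1, chainSum_eq_ysum hq0, coeff_ysum, coeff_ysum]
      refine sum_congr rfl fun a ha => ?_
      have ha := mem_range.mp ha
      simp only [Pi.zero_apply, mul_zero, sub_zero]
      rw [coeff_C_mul, coeff_C_mul]
      congr 1
      rcases Nat.eq_zero_or_pos a with rfl | hpos
      · have := coeff_chainSum_capWeight_zero q 0 m
        rw [Nat.sub_zero]
        refine this.trans ?_
        simp [qp_zero, ip, coeff_one]
      · exact ih (m - a) (by omega) a
  ext m
  exact key m R

/-- The indicator of the first `k` rows. -/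
def firstRows (k : ℕ) (t : ℕ) : ℤ := if t < k then 1 else 0

theorem capWeight_succ_succ (q : K) (a b : ℕ) : capWeight q (a + 1) (b + 1) = capWeight q a b := by
  simp [capWeight]

end PowerSeries

namespace PowerSeries

open Finset

variable {K : Type*} [Field K]

/-- The effect of lengthening by one row a column added to `n`. -/
theorem chainSum_firstRows_succ_sub {q : K} (hq0 : q ≠ 0) (hq : ∀ n, q ^ (n + 1) ≠ 1) (k : ℕ) :
    ∀ (ρ : ℕ → K) (n : ℕ → ℤ), (∀ t, k ≤ t → n t = 0) →
    chainSum q ρ (n + firstRows (k + 1)) - chainSum q ρ (n + firstRows k) =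
      X ^ (k + 1) * (C (q ^ (-∑ t ∈ range k, n t)) * geo q *
        rescale q (chainSum q (fun a => ρ (a + 1)) n)) := by
  induction k with
  | zero =>
    intro ρ n hn
    have hn0 : n = 0 := funext fun t => hn t (Nat.zero_le t)
    subst hn0
    rw [chainSum_eq_ysum hq0, chainSum_eq_ysum hq0 ρ, ← ysum_sub, chainSum_eq_ysum hq0 _ 0,
      rescale_ysum, mul_ysum, ysum_eq_zero_add]
    have h1 : (fun t => ((0 : ℕ → ℤ) + firstRows (0 + 1)) (t + 1)) = 0 := by
      funext t; simp [firstRows]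
    have h2 : (fun t => ((0 : ℕ → ℤ) + firstRows 0) (t + 1)) = 0 := by
      funext t; simp [firstRows]
    have h3 : (fun t => ((0 : ℕ → ℤ)) (t + 1)) = 0 := rfl
    simp only [h1, h2, h3, chainSum_capWeight_zero hq0 hq]
    rw [zero_add, pow_one, show ∀ a b c : K⟦X⟧, a = 0 → b = c → a + X * b = X * c by
      rintro a b c rfl rfl; simp]
    · simp
    · congr 1
      funext a
      have h4 : (1 - q ^ (a + 1)) ≠ 0 := sub_ne_zero.mpr (hq _).symm
      have h5 := qp_ne_zero hq a
      have h6 : ρ (a + 1) * q ^ (((a + 1 : ℕ) : ℤ) ^ 2 - ((a + 1 : ℕ) : ℤ)) * (qp q (a + 1))⁻¹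
          - ρ (a + 1) * q ^ (((a + 1 : ℕ) : ℤ) ^ 2) * (qp q (a + 1))⁻¹
          = q ^ a * (ρ (a + 1) * q ^ ((a : ℤ) ^ 2) * (qp q a)⁻¹) := by
        rw [qp_succ, show ((a + 1 : ℕ) : ℤ) ^ 2 - ((a + 1 : ℕ) : ℤ) = (a : ℤ) ^ 2 + (a : ℕ) by
          push_cast; ring, show ((a + 1 : ℕ) : ℤ) ^ 2 = (a : ℤ) ^ 2 + (a : ℕ) + ((a + 1 : ℕ) : ℤ) by
          push_cast; ring, zpow_add₀ hq0, zpow_add₀ hq0, zpow_add₀ hq0, zpow_natCast, zpow_natCast]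
        field_simp
      have h7 := congrArg (C : K → K⟦X⟧) h6
      simp only [map_mul, map_sub, rescale_const, ip_succ_eq_rescale, firstRows, Pi.zero_apply,
        Pi.add_apply] at h7 ⊢
      simp
      push_cast [map_pow] at h7
      linear_combination (geo q * rescale q (ip q a)) * h7
  | succ k ih =>
    intro ρ n hn
    have h1 : ∀ j, (fun t => (n + firstRows (j + 1)) (t + 1)) =
        (fun t => n (t + 1)) + firstRows j := fun j => by
      funext t; simp [firstRows]
    rw [chainSum_eq_ysum hq0, chainSum_eq_ysum hq0 ρ, ← ysum_sub, chainSum_eq_ysum hq0 _ n,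
      rescale_ysum, mul_ysum, mul_ysum, ysum_eq_zero_add]
    simp only [h1]
    have hn' : ∀ t, k ≤ t → n (t + 1) = 0 := fun t ht => hn _ (by omega)
    have h2 : ∀ j, (n + firstRows (j + 1)) 0 = n 0 + 1 := fun j => by simp [firstRows]
    simp only [h2, ← mul_sub]
    simp only [ih _ _ hn', capWeight_succ_succ]
    have h3 : chainSum q (fun a => capWeight q 0 (a + 1)) (fun t => n (t + 1)) = 0 := by
      ext m
      rw [coeff_chainSum]
      simp [capWeight]
    rw [h3]
    simp only [map_zero, mul_zero, zero_add]
    rw [mul_ysum]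
    congr 1
    funext b
    have h4 : q ^ (((b + 1 : ℕ) : ℤ) ^ 2 - ((b + 1 : ℕ) : ℤ) * (n 0 + 1)) *
        q ^ (-∑ t ∈ range k, n (t + 1)) = q ^ (-∑ t ∈ range (k + 1), n t) * (q ^ b *
          q ^ ((b : ℤ) ^ 2 - b * n 0)) := by
      rw [← zpow_natCast q b, ← zpow_add₀ hq0, ← zpow_add₀ hq0, ← zpow_add₀ hq0, sum_range_succ']
      congr 1
      push_cast
      ring
    have h7 := congrArg (C : K → K⟦X⟧) h4
    simp only [map_mul, rescale_const] at h7 ⊢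
    linear_combination (X ^ (k + 1 + 1) * C (ρ (b + 1)) * geo q *
      rescale q (chainSum q (capWeight q b) (fun t => n (t + 1)))) * h7

end PowerSeries

namespace PowerSeries

open Finset

variable {K : Type*} [Field K]

/-- The one-vertex generating function twisted by `n`. -/
noncomputable def vertexSum (q : K) (n : ℕ → ℤ) : K⟦X⟧ := chainSum q (fun _ => 1) n

theorem coeff_vertexSum (q : K) (n : ℕ → ℤ) (m : ℕ) :
    coeff m (vertexSum q n) = ∑ r ∈ descending m,
      stepWeight q r * q ^ (∑ᶠ t, ((r t : ℤ) ^ 2 - r t * n t)) := by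
  simp [vertexSum, coeff_chainSum]

theorem constantCoeff_vertexSum (q : K) (n : ℕ → ℤ) :
    constantCoeff (vertexSum q n) = 1 := by
  rw [← coeff_zero_eq_constantCoeff_apply, coeff_vertexSum]
  simp [descending_zero, stepWeight, qp_zero]

theorem vertexSum_zero_eq_ysum {q : K} (hq0 : q ≠ 0) (hq : ∀ n, q ^ (n + 1) ≠ 1) :
    vertexSum q 0 = ysum fun a => C (q ^ (a ^ 2) * (qp q a)⁻¹) * ip q a := by
  rw [vertexSum, chainSum_eq_ysum hq0]
  congr 1
  funext a
  have h3 : (fun t => ((0 : ℕ → ℤ)) (t + 1)) = 0 := rfl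
  rw [h3, chainSum_capWeight_zero hq0 hq, ← mul_assoc, ← map_mul]
  simp only [Pi.zero_apply, mul_zero, sub_zero, one_mul]
  rw [show q ^ ((a : ℤ) ^ 2) = q ^ (a ^ 2) by exact_mod_cast zpow_natCast q (a ^ 2)]

/-- The `q`-difference equation of the untwisted generating function. -/
theorem geo_mul_rescale_vertexSum_zero {q : K} (hq0 : q ≠ 0) (hq : ∀ n, q ^ (n + 1) ≠ 1) :
    geo q * rescale q (vertexSum q 0) = vertexSum q 0 := by
  rw [vertexSum_zero_eq_ysum hq0 hq, rescale_ysum, mul_ysum]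
  have h1 : (fun a => C (q ^ (a ^ 2) * (qp q a)⁻¹) * ip q a) =
      fun a => C (q ^ a * q ^ (a ^ 2) * (qp q a)⁻¹) * ip q a +
        C (q ^ (a ^ 2) * (1 - q ^ a) * (qp q a)⁻¹) * ip q a := by
    funext a
    rw [← add_mul, ← map_add]
    congr 2
    ring
  have h2 : ysum (fun a => C (q ^ (a ^ 2) * (1 - q ^ a) * (qp q a)⁻¹) * ip q a) =
      ysum fun a => X * (C (q ^ ((a + 1) ^ 2) * (qp q a)⁻¹) * ip q (a + 1)) := by
    rw [ysum_eq_zero_add, ← mul_ysum]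
    simp only [pow_zero, sub_self, mul_zero, zero_mul, map_zero, zero_add]
    congr 2
    funext a
    have h4 : (1 - q ^ (a + 1)) ≠ 0 := sub_ne_zero.mpr (hq _).symm
    have h5 := qp_ne_zero hq a
    rw [qp_succ]
    congr 2
    field_simp
  rw [h1, ysum_add, h2, ← ysum_add]
  congr 1
  funext a
  have h3 := ip_succ_eq_add q a
  have h4 : q ^ ((a + 1) ^ 2) = q ^ a * q ^ (a ^ 2) * q ^ (a + 1) := by ring
  rw [h4]
  simp only [map_mul, rescale_const]
  have h5 := ip_succ_eq_rescale q a
  linear_combination C (q ^ a) * C (q ^ (a ^ 2)) * C (qp q a)⁻¹ * (h3 - h5)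

theorem coeff_vertexSum_add_firstRows {q : K} (hq0 : q ≠ 0) (n : ℕ → ℤ) {i j : ℕ} (h : i ≤ j) :
    coeff i (vertexSum q (n + firstRows j)) = coeff i (rescale q⁻¹ (vertexSum q n)) := by
  rw [coeff_rescale, coeff_vertexSum, coeff_vertexSum, mul_sum]
  refine sum_congr rfl fun r hr => ?_
  obtain ⟨hr, hi⟩ := mem_descending.mp hr
  have h1 : ∑ᶠ t, ((r t : ℤ) ^ 2 - r t * (n + firstRows j) t) =
      ∑ᶠ t, ((r t : ℤ) ^ 2 - r t * n t) - i := by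
    have h2 : ∀ t, (r t : ℤ) ^ 2 - r t * (n + firstRows j) t =
        ((r t : ℤ) ^ 2 - r t * n t) - r t := fun t => by
      by_cases ht : t < j
      · simp [firstRows, ht]; ring
      · have : r t = 0 := hr.eq_zero_of_finsum_le (by omega)
        simp [this]
    rw [finsum_congr h2, finsum_sub_distrib]
    · congr 1
      rw [← hi]
      exact ((Nat.castAddMonoidHom ℤ).map_finsum hr.finite_support).symm
    · exact hr.finite_support_of fun t ht => by simp [ht]
    · exact hr.finite_support_of fun t ht => by simp [ht]
  rw [h1, zpow_sub₀ hq0, zpow_natCast, inv_pow]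
  ring

theorem vertexSum_firstRows_add_sub {q : K} (hq0 : q ≠ 0) (hq : ∀ n, q ^ (n + 1) ≠ 1) (k : ℕ)
    (n : ℕ → ℤ) (hn : ∀ t, k ≤ t → n t = 0) (N : ℕ) :
    (1 - X) * (vertexSum q (n + firstRows (k + N)) - vertexSum q (n + firstRows k)) =
      X ^ (k + 1) * (1 - X ^ N) * (C (q ^ (-∑ t ∈ range k, n t)) * geo q *
        rescale q (vertexSum q n)) := by
  induction N with
  | zero => simp
  | succ N ih =>
    have h1 := chainSum_firstRows_succ_sub hq0 hq (k + N) (fun _ => 1) n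
      (fun t ht => hn t (by omega))
    have h2 : ∑ t ∈ range (k + N), n t = ∑ t ∈ range k, n t := by
      refine (sum_subset (range_mono (by omega)) fun t _ ht => hn t ?_).symm
      simpa using ht
    rw [h2] at h1
    change vertexSum q _ - vertexSum q _ = _ * (_ * rescale q (vertexSum q _)) at h1
    rw [← add_assoc k N 1]
    linear_combination ih + (1 - X) * h1

theorem one_sub_X_mul_rescale_sub {q : K} (hq0 : q ≠ 0) (hq : ∀ n, q ^ (n + 1) ≠ 1) (k : ℕ)
    (n : ℕ → ℤ) (hn : ∀ t, k ≤ t → n t = 0) :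
    (1 - X) * (rescale q⁻¹ (vertexSum q n) - vertexSum q (n + firstRows k)) =
      X ^ (k + 1) * (C (q ^ (-∑ t ∈ range k, n t)) * geo q * rescale q (vertexSum q n)) := by
  rw [← sub_eq_zero]
  have key : ∀ N : ℕ, (X : K⟦X⟧) ^ N ∣
      (1 - X) * (rescale q⁻¹ (vertexSum q n) - vertexSum q (n + firstRows k)) -
      X ^ (k + 1) * (C (q ^ (-∑ t ∈ range k, n t)) * geo q * rescale q (vertexSum q n)) := by
    intro N
    have h1 := vertexSum_firstRows_add_sub hq0 hq k n hn N
    have h2 : (X : K⟦X⟧) ^ N ∣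
        rescale q⁻¹ (vertexSum q n) - vertexSum q (n + firstRows (k + N)) := by
      rw [X_pow_dvd_iff]
      intro m hm
      rw [map_sub, coeff_vertexSum_add_firstRows hq0 n (by omega), sub_self]
    have h3 : (1 - X) * (rescale q⁻¹ (vertexSum q n) - vertexSum q (n + firstRows k)) -
        X ^ (k + 1) * (C (q ^ (-∑ t ∈ range k, n t)) * geo q * rescale q (vertexSum q n)) =
        (1 - X) * (rescale q⁻¹ (vertexSum q n) - vertexSum q (n + firstRows (k + N))) -
        X ^ N * (X ^ (k + 1) * (C (q ^ (-∑ t ∈ range k, n t)) * geo q *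
          rescale q (vertexSum q n))) := by
      linear_combination h1
    rw [h3]
    exact dvd_sub (h2.mul_left _) (dvd_mul_right _ _)
  ext m
  exact X_pow_dvd_iff.mp (key (m + 1)) m (Nat.lt_succ_self m)

/-- The twisted generating function divided by the untwisted one. -/
noncomputable def twist (q : K) (n : ℕ → ℤ) : K⟦X⟧ := vertexSum q n * (vertexSum q 0)⁻¹

theorem vertexSum_zero_mul_inv (q : K) : vertexSum q 0 * (vertexSum q 0)⁻¹ = 1 :=
  PowerSeries.mul_inv_cancel _ (by simp [constantCoeff_vertexSum])

theorem vertexSum_eq_mul_twist (q : K) (n : ℕ → ℤ) :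
    vertexSum q n = vertexSum q 0 * twist q n := by
  have := vertexSum_zero_mul_inv q
  unfold twist
  linear_combination (-vertexSum q n) * this

theorem one_sub_X_mul_twist {q : K} (hq0 : q ≠ 0) (hq : ∀ n, q ^ (n + 1) ≠ 1) (k : ℕ)
    (n : ℕ → ℤ) (hn : ∀ t, k ≤ t → n t = 0) :
    (1 - X) * twist q (n + firstRows k) = rescale q⁻¹ (twist q n) -
      X ^ (k + 1) * (C (q ^ (-∑ t ∈ range k, n t)) * rescale q (twist q n)) := by
  have h1 := one_sub_X_mul_rescale_sub hq0 hq k n hn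
  have h2 := geo_mul_rescale_vertexSum_zero hq0 hq
  have h3 : (1 - X) * rescale q⁻¹ (vertexSum q 0) = vertexSum q 0 := by
    have h4 := congrArg (rescale q⁻¹) h2
    rw [map_mul, rescale_geo, rescale_rescale, mul_inv_cancel₀ hq0, inv_mul_cancel₀ hq0,
      rescale_one, RingHom.id_apply] at h4
    rw [← h4, ← mul_assoc]
    have := one_sub_mul_geo (1 : K)
    rw [map_one, one_mul] at this
    rw [this, one_mul]
  rw [vertexSum_eq_mul_twist q n, vertexSum_eq_mul_twist q (n + firstRows k)] at h1
  simp only [map_mul] at h1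
  have h5 : vertexSum q 0 ≠ 0 := fun h => by
    have := constantCoeff_vertexSum q 0
    simp [h] at this
  refine mul_left_cancel₀ h5 ?_
  linear_combination (-1 : K⟦X⟧) * h1 + rescale q⁻¹ (twist q n) * h3 -
    X ^ (k + 1) * C (q ^ (-∑ t ∈ range k, n t)) * rescale q (twist q n) * h2

/-- The coefficients of a power series extended by zero to negative indices. -/
noncomputable def icoeff (g : K⟦X⟧) (i : ℤ) : K := if 0 ≤ i then coeff i.toNat g else 0

theorem icoeff_natCast (g : K⟦X⟧) (i : ℕ) : icoeff g i = coeff i g := by simp [icoeff]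

theorem icoeff_of_neg (g : K⟦X⟧) {i : ℤ} (h : i < 0) : icoeff g i = 0 := by
  simp [icoeff, not_le.mpr h]

theorem icoeff_sub (g h : K⟦X⟧) (i : ℤ) : icoeff (g - h) i = icoeff g i - icoeff h i := by
  unfold icoeff
  split_ifs <;> simp

theorem icoeff_C_mul (a : K) (g : K⟦X⟧) (i : ℤ) : icoeff (C a * g) i = a * icoeff g i := by
  unfold icoeff
  split_ifs <;> simp

theorem icoeff_rescale (a : K) (g : K⟦X⟧) (i : ℤ) :
    icoeff (rescale a g) i = a ^ i * icoeff g i := by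
  unfold icoeff
  split_ifs with h
  · rw [coeff_rescale, ← zpow_natCast, Int.toNat_of_nonneg h]
  · simp

theorem icoeff_X_pow_mul (k : ℕ) (g : K⟦X⟧) (i : ℤ) :
    icoeff (X ^ k * g) i = icoeff g (i - k) := by
  unfold icoeff
  by_cases h : 0 ≤ i
  · rw [if_pos h, coeff_X_pow_mul']
    split_ifs with h1 h2 h2
    · congr 2; omega
    · omega
    · omega
    · rfl
  · rw [if_neg h, if_neg (by omega)]

/-- `g` is a palindromic polynomial of degree at most `d`. -/
def IsPalindromic (d : ℤ) (g : K⟦X⟧) : Prop := ∀ i, icoeff g i = icoeff g (d - i)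

theorem IsPalindromic.of_one_sub_X_mul [CharZero K] {q : K} (hq0 : q ≠ 0) {d : ℤ} {g g' : K⟦X⟧}
    {k : ℕ} (hg : IsPalindromic d g)
    (h : (1 - X) * g' = rescale q⁻¹ g - X ^ (k + 1) * (C (q ^ (-d)) * rescale q g)) :
    IsPalindromic (d + k) g' := by
  have h1 : ∀ i, icoeff g' i - icoeff g' (i - 1) =
      q ^ (-i) * icoeff g i - q ^ (-d) * q ^ (i - k - 1) * icoeff g (i - k - 1) := fun i => by
    have h2 := congrArg (fun u => icoeff u i) h
    have h3 : (1 - X) * g' = g' - X ^ 1 * g' := by ring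
    simp only [h3] at h2
    rw [icoeff_sub, icoeff_sub, icoeff_X_pow_mul, icoeff_X_pow_mul, icoeff_C_mul, icoeff_rescale,
      icoeff_rescale, inv_zpow', show i - ((k + 1 : ℕ) : ℤ) = i - k - 1 by push_cast; ring] at h2
    rw [mul_assoc]
    exact_mod_cast h2
  have h4 : ∀ i, icoeff g' i - icoeff g' (d + k - i) =
      icoeff g' (i - 1) - icoeff g' (d + k - (i - 1)) := fun i => by
    have h5 := h1 i
    have h6 := h1 (d + k - (i - 1))
    rw [hg i] at h5
    rw [hg (d + k - (i - 1))] at h6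
    rw [← zpow_add₀ hq0] at h5 h6
    rw [show d - (d + k - (i - 1)) = i - k - 1 by ring,
      show d + k - (i - 1) - k - 1 = d - i by ring, show d + k - (i - 1) - 1 = d + k - i by ring,
      show -(d + k - (i - 1)) = -d + (i - k - 1) by ring, show -d + (d - i) = -i by ring] at h6
    linear_combination h5 + h6
  have h7 : ∀ i, icoeff g' i - icoeff g' (d + k - i) =
      icoeff g' 0 - icoeff g' (d + k - 0) := fun i => by
    induction i with
    | zero => rfl
    | succ i ih =>
      rw [h4, add_sub_cancel_right]
      exact ih
    | pred i ih =>
      rw [← ih, h4 (-i)]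
  intro i
  have h8 := h7 i
  have h9 := h7 (d + k - i)
  rw [sub_sub_cancel] at h9
  rw [← h8] at h9
  have h10 : (2 : K) * (icoeff g' i - icoeff g' (d + k - i)) = 0 := by linear_combination -h9
  exact sub_eq_zero.mp ((mul_eq_zero.mp h10).resolve_left two_ne_zero)

theorem isPalindromic_twist [CharZero K] {q : K} (hq0 : q ≠ 0) (hq : ∀ n, q ^ (n + 1) ≠ 1)
    {ν : ℕ → ℕ} (hν : IsDescending ν) :
    IsPalindromic ((∑ᶠ t, ν t : ℕ) : ℤ) (twist q fun t => (ν t : ℤ)) := by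
  obtain ⟨M, hM⟩ : ∃ M, ν 0 = M := ⟨_, rfl⟩
  induction M generalizing ν with
  | zero =>
    have hν0 : ν = 0 := funext fun t => Nat.le_zero.mp ((hν.1 (Nat.zero_le t)).trans hM.le)
    subst hν0
    have h1 : (twist q fun t => (((0 : ℕ → ℕ) t : ℕ) : ℤ)) = 1 := by
      have : (fun t : ℕ => (((0 : ℕ → ℕ) t : ℕ) : ℤ)) = 0 := by funext t; simp
      rw [this]
      exact vertexSum_zero_mul_inv q
    rw [h1]
    intro i
    simp only [Pi.zero_apply, finsum_zero, Nat.cast_zero, zero_sub, icoeff, coeff_one]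
    split_ifs <;> first | rfl | omega
  | succ M ih =>
    have hex : ∃ k, ν k = 0 := by
      obtain ⟨N, hN⟩ := hν.2
      exact ⟨N, hN N le_rfl⟩
    classical
    set k := Nat.find hex with hk
    have hk0 : ∀ t, k ≤ t → ν t = 0 := fun t ht => by
      have h1 := hν.1 ht
      have h2 := Nat.find_spec hex
      rw [← hk] at h2
      omega
    have hk1 : ∀ t, t < k → ν t ≠ 0 := fun t ht => Nat.find_min hex ht
    have hν' : IsDescending (fun t => ν t - 1) := by
      refine ⟨fun a b hab => Nat.sub_le_sub_right (hν.1 hab) 1, k, fun t ht => ?_⟩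
      simp [hk0 t ht]
    have h1 := ih hν' (by simp [hM])
    have h2 : (fun t => (ν t : ℤ)) = (fun t => ((ν t - 1 : ℕ) : ℤ)) + firstRows k := by
      funext t
      simp only [Pi.add_apply, firstRows]
      split_ifs with ht
      · have := hk1 t ht; omega
      · have := hk0 t (by omega); omega
    have hs : ∀ μ : ℕ → ℕ, (∀ t, k ≤ t → μ t = 0) → ∑ᶠ t, μ t = ∑ t ∈ range k, μ t :=
      fun μ hμ => finsum_eq_sum_of_support_subset _ fun t ht => by
        by_contra hc
        exact ht (hμ t (by simpa using hc))
    have hν0' : ∀ t, k ≤ t → ν t - 1 = 0 := fun t ht => by simp [hk0 t ht]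
    have h3 : ((∑ᶠ t, ν t : ℕ) : ℤ) = ((∑ᶠ t, (ν t - 1) : ℕ) : ℤ) + k := by
      rw [hs _ hk0, hs _ hν0']
      have : ∑ t ∈ range k, ν t = ∑ t ∈ range k, ((ν t - 1) + 1) :=
        sum_congr rfl fun t ht => by
          have := hk1 t (mem_range.mp ht)
          omega
      rw [this, sum_add_distrib]
      simp
    rw [h2, h3]
    refine h1.of_one_sub_X_mul hq0 ?_
    rw [one_sub_X_mul_twist hq0 hq k _ (fun t ht => by simp [hk0 t ht]), hs _ hν0']
    push_cast
    rfl

end PowerSeries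

section SubstMonomial

open Finset PowerSeries

variable {K : Type*} [CommRing K] {σ : Type*}

/-- Substitution of the monomial with exponent `α` into a power series in one variable. -/
noncomputable def substMonomial (α : σ →₀ ℕ) (F : PowerSeries K) : MvPowerSeries σ K :=
  PowerSeries.subst (MvPowerSeries.monomial α (1 : K)) F

theorem coeff_substMonomial [DecidableEq σ] {α : σ →₀ ℕ} (hα : α ≠ 0) (F : PowerSeries K)
    (d : σ →₀ ℕ) : MvPowerSeries.coeff d (substMonomial α F) =
      ∑ᶠ n : ℕ, if d = n • α then PowerSeries.coeff n F else 0 := by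
  rw [substMonomial, PowerSeries.coeff_subst (PowerSeries.HasSubst.monomial hα 1)]
  refine finsum_congr fun n => ?_
  rw [MvPowerSeries.monomial_pow, one_pow, MvPowerSeries.coeff_monomial]
  split_ifs <;> simp

theorem nsmul_finsupp_injective {α : σ →₀ ℕ} (hα : α ≠ 0) {m n : ℕ} (h : m • α = n • α) :
    m = n := by
  obtain ⟨j, hj⟩ := Finsupp.ne_iff.mp hα
  have := DFunLike.congr_fun h j
  simp only [Finsupp.smul_apply, smul_eq_mul] at this
  exact Nat.eq_of_mul_eq_mul_right (Nat.pos_of_ne_zero hj) this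

theorem coeff_nsmul_substMonomial {α : σ →₀ ℕ} (hα : α ≠ 0) (F : PowerSeries K) (n : ℕ) :
    MvPowerSeries.coeff (n • α) (substMonomial α F) = PowerSeries.coeff n F := by
  classical
  rw [coeff_substMonomial hα, finsum_eq_single _ n, if_pos rfl]
  intro m hm
  exact if_neg fun h => hm (nsmul_finsupp_injective hα h).symm

theorem coeff_substMonomial_eq_zero {α : σ →₀ ℕ} (hα : α ≠ 0) (F : PowerSeries K) {d : σ →₀ ℕ}
    (hd : ∀ n : ℕ, d ≠ n • α) : MvPowerSeries.coeff d (substMonomial α F) = 0 := by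
  classical
  rw [coeff_substMonomial hα]
  exact finsum_eq_zero_of_forall_eq_zero fun n => if_neg (hd n)

theorem substMonomial_mul {α : σ →₀ ℕ} (hα : α ≠ 0) (F G : PowerSeries K) :
    substMonomial α (F * G) = substMonomial α F * substMonomial α G :=
  PowerSeries.subst_mul (PowerSeries.HasSubst.monomial hα 1) F G

theorem substMonomial_one {α : σ →₀ ℕ} (hα : α ≠ 0) :
    substMonomial α (1 : PowerSeries K) = 1 := by
  rw [substMonomial, ← PowerSeries.coe_substAlgHom (PowerSeries.HasSubst.monomial hα (1 : K)),
    map_one]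

end SubstMonomial

section Reflection

open Finset PowerSeries

variable {K : Type*} [Field K] {σ : Type*}

/-- Replace one coordinate of a finitely supported function. -/
noncomputable def setCoord (d : σ →₀ ℕ) (i : σ) (x : ℕ) : σ →₀ ℕ := d.update i x

theorem setCoord_same (d : σ →₀ ℕ) (i : σ) (x : ℕ) : setCoord d i x i = x := by
  classical
  simp [setCoord]

theorem setCoord_of_ne (d : σ →₀ ℕ) {i j : σ} (x : ℕ) (h : j ≠ i) : setCoord d i x j = d j := by
  classical
  simp [setCoord, Function.update_of_ne h]

theorem setCoord_setCoord (d : σ →₀ ℕ) (i : σ) (x y : ℕ) :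
    setCoord (setCoord d i x) i y = setCoord d i y := by
  ext j
  by_cases h : j = i
  · subst h; simp [setCoord_same]
  · simp [setCoord_of_ne _ _ h]

theorem coeff_substMonomial_single_mul (i : σ) (F : PowerSeries K) (G : MvPowerSeries σ K)
    (d : σ →₀ ℕ) : MvPowerSeries.coeff d (substMonomial (Finsupp.single i 1) F * G) =
      ∑ p ∈ antidiagonal (d i), PowerSeries.coeff p.1 F *
        MvPowerSeries.coeff (setCoord d i p.2) G := by
  classical
  have hne : (Finsupp.single i 1 : σ →₀ ℕ) ≠ 0 := by simp
  rw [MvPowerSeries.coeff_mul]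
  symm
  refine sum_of_injOn (fun p => (p.1 • Finsupp.single i 1, setCoord d i p.2)) ?_ ?_ ?_ ?_
  · rintro ⟨a, b⟩ h1 ⟨a', b'⟩ h2 h
    simp only [Prod.mk.injEq] at h
    have e1 := nsmul_finsupp_injective hne h.1
    have e2 := DFunLike.congr_fun h.2 i
    simp only [setCoord_same] at e2
    rw [e1, e2]
  · rintro ⟨a, b⟩ h
    simp only [mem_coe, HasAntidiagonal.mem_antidiagonal] at h ⊢
    ext j
    by_cases hj : j = i
    · subst hj; simp [setCoord_same, h]
    · simp [setCoord_of_ne _ _ hj, Ne.symm hj]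
  · rintro ⟨u, v⟩ huv hnot
    rw [HasAntidiagonal.mem_antidiagonal] at huv
    rw [coeff_substMonomial_eq_zero hne, zero_mul]
    intro n hn
    refine hnot ⟨(n, v i), ?_, ?_⟩
    · rw [mem_coe, HasAntidiagonal.mem_antidiagonal, ← huv]
      simp only at hn
      simp [hn]
    · simp only [Prod.mk.injEq]
      refine ⟨hn.symm, ?_⟩
      ext j
      simp only at hn
      by_cases hj : j = i
      · subst hj; simp [setCoord_same]
      · rw [setCoord_of_ne _ _ hj, ← huv, hn]
        simp [Ne.symm hj]
  · rintro ⟨a, b⟩ h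
    rw [coeff_nsmul_substMonomial hne]

variable [Fintype σ]

/-- The neighbour sum `∑_j A i j * d j`. -/
def nbr (A : σ → σ → ℕ) (i : σ) (d : σ →₀ ℕ) : ℕ := ∑ j, A i j * d j

/-- The simple reflection at `i`, on the cone `d i ≤ nbr A i d`. -/
noncomputable def reflect (A : σ → σ → ℕ) (i : σ) (d : σ →₀ ℕ) : σ →₀ ℕ :=
  setCoord d i (nbr A i d - d i)

variable {A : σ → σ → ℕ} {i : σ}

theorem nbr_add (d e : σ →₀ ℕ) : nbr A i (d + e) = nbr A i d + nbr A i e := by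
  simp [nbr, mul_add, sum_add_distrib]

theorem nbr_nsmul (n : ℕ) (d : σ →₀ ℕ) : nbr A i (n • d) = n * nbr A i d := by
  simp only [nbr, mul_sum, Finsupp.smul_apply, smul_eq_mul]
  exact sum_congr rfl fun j _ => by ring

theorem nbr_setCoord (hA : A i i = 0) (d : σ →₀ ℕ) (x : ℕ) :
    nbr A i (setCoord d i x) = nbr A i d := by
  refine sum_congr rfl fun j _ => ?_
  by_cases h : j = i
  · subst h; simp [hA]
  · rw [setCoord_of_ne _ _ h]

theorem reflect_same (d : σ →₀ ℕ) : reflect A i d i = nbr A i d - d i := setCoord_same _ _ _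

theorem reflect_of_ne (d : σ →₀ ℕ) {j : σ} (h : j ≠ i) : reflect A i d j = d j :=
  setCoord_of_ne _ _ h

theorem nbr_reflect (hA : A i i = 0) (d : σ →₀ ℕ) : nbr A i (reflect A i d) = nbr A i d :=
  nbr_setCoord hA _ _

theorem reflect_mem_cone (hA : A i i = 0) (d : σ →₀ ℕ) :
    reflect A i d i ≤ nbr A i (reflect A i d) := by
  rw [nbr_reflect hA, reflect_same]
  omega

theorem reflect_reflect (hA : A i i = 0) {d : σ →₀ ℕ} (hd : d i ≤ nbr A i d) :
    reflect A i (reflect A i d) = d := by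
  ext j
  by_cases h : j = i
  · subst h
    rw [reflect_same, nbr_reflect hA, reflect_same]
    omega
  · rw [reflect_of_ne _ h, reflect_of_ne _ h]

theorem reflect_add {d e : σ →₀ ℕ} (hd : d i ≤ nbr A i d) (he : e i ≤ nbr A i e) :
    reflect A i (d + e) = reflect A i d + reflect A i e := by
  ext j
  by_cases h : j = i
  · subst h
    rw [Finsupp.add_apply, reflect_same, reflect_same, reflect_same, nbr_add, Finsupp.add_apply]
    omega
  · rw [Finsupp.add_apply, reflect_of_ne _ h, reflect_of_ne _ h, reflect_of_ne _ h,
      Finsupp.add_apply]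

theorem reflect_nsmul (n : ℕ) (d : σ →₀ ℕ) :
    reflect A i (n • d) = n • reflect A i d := by
  ext j
  by_cases h : j = i
  · subst h
    simp only [Finsupp.smul_apply, reflect_same, nbr_nsmul, smul_eq_mul, Nat.mul_sub]
  · simp only [Finsupp.smul_apply, reflect_of_ne _ h]

/-- `G` is obtained from `F` by reflecting exponents at `i`. -/
structure IsReflection (A : σ → σ → ℕ) (i : σ) (F G : MvPowerSeries σ K) : Prop where
  coeff_eq : ∀ d, d i ≤ nbr A i d →
    MvPowerSeries.coeff d F = MvPowerSeries.coeff (reflect A i d) G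
  left_eq_zero : ∀ d, ¬ d i ≤ nbr A i d → MvPowerSeries.coeff d F = 0
  right_eq_zero : ∀ d, ¬ d i ≤ nbr A i d → MvPowerSeries.coeff d G = 0

theorem IsReflection.one (hA : A i i = 0) : IsReflection A i (1 : MvPowerSeries σ K) 1 := by
  classical
  have h0 : ∀ d : σ →₀ ℕ, ¬ d i ≤ nbr A i d → MvPowerSeries.coeff d (1 : MvPowerSeries σ K) = 0 :=
    fun d hd => by
      rw [MvPowerSeries.coeff_one, if_neg]
      rintro rfl
      simp at hd
  refine ⟨fun d hd => ?_, h0, h0⟩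
  rw [MvPowerSeries.coeff_one, MvPowerSeries.coeff_one]
  have hz : reflect A i 0 = 0 := by simpa using reflect_nsmul (A := A) (i := i) 0 0
  refine if_congr ⟨?_, fun h => ?_⟩ rfl rfl
  · rintro rfl; exact hz
  · rw [← reflect_reflect hA hd, h, hz]

theorem IsReflection.mul (hA : A i i = 0) {F G F' G' : MvPowerSeries σ K}
    (h : IsReflection A i F G) (h' : IsReflection A i F' G') :
    IsReflection A i (F * F') (G * G') := by
  classical
  have hz : ∀ H H' : MvPowerSeries σ K,
      (∀ d, ¬ d i ≤ nbr A i d → MvPowerSeries.coeff d H = 0) →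
      (∀ d, ¬ d i ≤ nbr A i d → MvPowerSeries.coeff d H' = 0) →
      ∀ d, ¬ d i ≤ nbr A i d → MvPowerSeries.coeff d (H * H') = 0 := by
    intro H H' hH hH' d hd
    rw [MvPowerSeries.coeff_mul]
    refine sum_eq_zero fun p hp => ?_
    rw [HasAntidiagonal.mem_antidiagonal] at hp
    by_cases h1 : p.1 i ≤ nbr A i p.1
    · by_cases h2 : p.2 i ≤ nbr A i p.2
      · refine absurd ?_ hd
        rw [← hp, nbr_add, Finsupp.add_apply]
        omega
      · rw [hH' _ h2, mul_zero]
    · rw [hH _ h1, zero_mul]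
  refine ⟨fun d hd => ?_, hz _ _ h.left_eq_zero h'.left_eq_zero,
    hz _ _ h.right_eq_zero h'.right_eq_zero⟩
  rw [MvPowerSeries.coeff_mul, MvPowerSeries.coeff_mul]
  have hmem : ∀ (e : σ →₀ ℕ) (p : (σ →₀ ℕ) × (σ →₀ ℕ)), p ∈ antidiagonal e →
      p.1 i ≤ nbr A i p.1 → p.2 i ≤ nbr A i p.2 →
      (reflect A i p.1, reflect A i p.2) ∈ antidiagonal (reflect A i e) := by
    intro e p hp h1 h2
    rw [HasAntidiagonal.mem_antidiagonal] at hp ⊢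
    rw [← hp, reflect_add h1 h2]
  refine sum_bij_ne_zero (fun p _ _ => (reflect A i p.1, reflect A i p.2)) ?_ ?_ ?_ ?_
  · intro p hp hne
    exact hmem d p hp (not_not.mp fun hc => hne (by rw [h.left_eq_zero _ hc, zero_mul]))
      (not_not.mp fun hc => hne (by rw [h'.left_eq_zero _ hc, mul_zero]))
  · intro p hp hne p' hp' hne' heq
    have c1 := not_not.mp fun hc => hne (by rw [h.left_eq_zero _ hc, zero_mul])
    have c2 := not_not.mp fun hc => hne (by rw [h'.left_eq_zero _ hc, mul_zero])
    have c1' := not_not.mp fun hc => hne' (by rw [h.left_eq_zero _ hc, zero_mul])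
    have c2' := not_not.mp fun hc => hne' (by rw [h'.left_eq_zero _ hc, mul_zero])
    simp only [Prod.mk.injEq] at heq
    refine Prod.ext ?_ ?_
    · rw [← reflect_reflect hA c1, heq.1, reflect_reflect hA c1']
    · rw [← reflect_reflect hA c2, heq.2, reflect_reflect hA c2']
  · intro p hp hne
    have c1 := not_not.mp fun hc => hne (by rw [h.right_eq_zero _ hc, zero_mul])
    have c2 := not_not.mp fun hc => hne (by rw [h'.right_eq_zero _ hc, mul_zero])
    refine ⟨(reflect A i p.1, reflect A i p.2), ?_, ?_, ?_⟩
    · have := hmem _ p hp c1 c2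
      rwa [reflect_reflect hA hd] at this
    · rw [h.coeff_eq _ (reflect_mem_cone hA _), h'.coeff_eq _ (reflect_mem_cone hA _),
        reflect_reflect hA c1, reflect_reflect hA c2]
      exact hne
    · simp only [reflect_reflect hA c1, reflect_reflect hA c2]
  · intro p hp hne
    have c1 := not_not.mp fun hc => hne (by rw [h.left_eq_zero _ hc, zero_mul])
    have c2 := not_not.mp fun hc => hne (by rw [h'.left_eq_zero _ hc, mul_zero])
    rw [h.coeff_eq _ c1, h'.coeff_eq _ c2]

theorem IsReflection.prod (hA : A i i = 0) {ι : Type*} (s : Finset ι)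
    {F G : ι → MvPowerSeries σ K} (h : ∀ a ∈ s, IsReflection A i (F a) (G a)) :
    IsReflection A i (∏ a ∈ s, F a) (∏ a ∈ s, G a) := by
  classical
  induction s using Finset.induction_on with
  | empty => simpa using IsReflection.one hA
  | insert a s ha ih =>
    rw [prod_insert ha, prod_insert ha]
    exact (h a (mem_insert_self a s)).mul hA (ih fun b hb => h b (mem_insert_of_mem hb))

theorem isReflection_substMonomial (hA : A i i = 0) {α : σ →₀ ℕ} (h0 : α ≠ 0)
    (hα : α i ≤ nbr A i α) (F : PowerSeries K) :
    IsReflection A i (substMonomial α F) (substMonomial (reflect A i α) F) := by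
  have h0' : reflect A i α ≠ 0 := fun h => h0 <| by
    rw [← reflect_reflect hA hα, h]
    simpa using reflect_nsmul (A := A) (i := i) 0 0
  have hz : ∀ β : σ →₀ ℕ, β ≠ 0 → β i ≤ nbr A i β → ∀ d : σ →₀ ℕ, ¬ d i ≤ nbr A i d →
      MvPowerSeries.coeff d (substMonomial β F) = 0 := by
    intro β hβ0 hβ d hd
    refine coeff_substMonomial_eq_zero hβ0 F ?_
    rintro n rfl
    refine hd ?_
    rw [nbr_nsmul]
    exact Nat.mul_le_mul_left n hβ
  refine ⟨fun d hd => ?_, hz α h0 hα, hz _ h0' (reflect_mem_cone hA α)⟩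
  by_cases hn : ∃ n : ℕ, d = n • α
  · obtain ⟨n, rfl⟩ := hn
    rw [coeff_nsmul_substMonomial h0, reflect_nsmul, coeff_nsmul_substMonomial h0']
  · push Not at hn
    rw [coeff_substMonomial_eq_zero h0 F hn, coeff_substMonomial_eq_zero h0']
    intro n h
    refine hn n ?_
    rw [← reflect_reflect hA hd, h, reflect_nsmul, reflect_reflect hA hα]

/-- A reflection-invariant series with constant term `1` is `1` when every nonzero exponent can
be decreased by some simple reflection. -/
theorem eq_one_of_isReflection {T : MvPowerSeries σ K} (hA : ∀ i, A i i = 0)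
    (hT0 : MvPowerSeries.coeff 0 T = 1) (hT : ∀ i, IsReflection A i T T)
    (hpos : ∀ d : σ →₀ ℕ, d ≠ 0 → ∃ i, nbr A i d < 2 * d i) : T = 1 := by
  classical
  have key : ∀ (m : ℕ) (d : σ →₀ ℕ), d ≠ 0 → ∑ j, d j = m → MvPowerSeries.coeff d T = 0 := by
    intro m
    induction m using Nat.strong_induction_on with
    | _ m ih =>
      intro d hd hm
      obtain ⟨i, hi⟩ := hpos d hd
      by_cases hc : d i ≤ nbr A i d
      · rw [(hT i).coeff_eq d hc]
        refine ih (∑ j, reflect A i d j) ?_ _ ?_ rfl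
        · rw [← hm]
          refine sum_lt_sum (fun j _ => ?_) ⟨i, mem_univ i, ?_⟩
          · by_cases h : j = i
            · subst h; rw [reflect_same]; omega
            · rw [reflect_of_ne _ h]
          · rw [reflect_same]; omega
        · intro h
          refine hd ?_
          rw [← reflect_reflect (hA i) hc, h]
          simpa using reflect_nsmul (A := A) (i := i) 0 0
      · exact (hT i).left_eq_zero d hc
  ext d
  rw [MvPowerSeries.coeff_one]
  split_ifs with h
  · rw [h, hT0]
  · exact key _ d h rfl

end Reflection

section QuiverSum

open Finset PowerSeries

variable {K : Type*} [Field K] {σ : Type*} [Fintype σ]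

theorem finite_support_tuple {M : Type*} [Zero M] {r : σ → ℕ → ℕ} (hr : ∀ i, IsDescending (r i))
    {g : ℕ → M} (hg : ∀ t, (∀ i, r i t = 0) → g t = 0) : (Function.support g).Finite := by
  have h := IsDescending.sum_mul univ (fun _ => 1) (fun i _ => hr i)
  refine h.finite_support_of fun t ht => hg t fun i => ?_
  simp only [one_mul, sum_eq_zero_iff, mem_univ, true_implies] at ht
  exact ht i

/-- The sum of the rows adjacent to `i`. -/
def nbrRow (A : σ → σ → ℕ) (i : σ) (r : σ → ℕ → ℕ) (t : ℕ) : ℕ := ∑ j, A i j * r j t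

theorem finsum_nbrRow {A : σ → σ → ℕ} {i : σ} {d : σ →₀ ℕ} {r : σ → ℕ → ℕ}
    (hr : ∀ j, r j ∈ descending (d j)) : ∑ᶠ t, nbrRow A i r t = nbr A i d := by
  unfold nbrRow nbr
  rw [finsum_sum_comm]
  · refine sum_congr rfl fun j _ => ?_
    rw [← smul_eq_mul (A i j), ← (mem_descending.mp (hr j)).2,
      smul_finsum' _ (mem_descending.mp (hr j)).1.finite_support]
    rfl
  · exact fun j _ => (mem_descending.mp (hr j)).1.finite_support_of fun t ht => by simp [ht]

variable [DecidableEq σ]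

/-- The weight of a tuple of descending sequences for the exponent function `e`. -/
noncomputable def tupleWeight (q : K) (e : (σ → ℤ) → ℤ) (r : σ → ℕ → ℕ) : K :=
  q ^ (∑ᶠ t, e fun i => (r i t : ℤ)) * ∏ i, stepWeight q (r i)

/-- The generating function of tuples of descending sequences. -/
noncomputable def quiverSum (q : K) (e : (σ → ℤ) → ℤ) : MvPowerSeries σ K :=
  fun d => ∑ r ∈ Fintype.piFinset (fun i => descending (d i)), tupleWeight q e r

theorem coeff_quiverSum (q : K) (e : (σ → ℤ) → ℤ) (d : σ →₀ ℕ) :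
    MvPowerSeries.coeff d (quiverSum q e) =
      ∑ r ∈ Fintype.piFinset (fun i => descending (d i)), tupleWeight q e r := rfl

theorem stepWeight_zero (q : K) : stepWeight q 0 = 1 := by simp [stepWeight, qp_zero]

theorem tupleWeight_update {q : K} (hq0 : q ≠ 0) {e : (σ → ℤ) → ℤ} (he0 : e 0 = 0)
    {A : σ → σ → ℕ} {i : σ}
    (he : ∀ v x, e (Function.update v i x) =
      e (Function.update v i 0) + x ^ 2 - x * ∑ j, (A i j : ℤ) * v j)
    {r : σ → ℕ → ℕ} (hr : ∀ j, IsDescending (r j)) (hri : r i = 0) {s : ℕ → ℕ}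
    (hs : IsDescending s) :
    tupleWeight q e (Function.update r i s) = tupleWeight q e r *
      (stepWeight q s * q ^ (∑ᶠ t, ((s t : ℤ) ^ 2 - s t * (nbrRow A i r t : ℤ)))) := by
  have h1 : ∏ j, stepWeight q (Function.update r i s j) =
      stepWeight q s * ∏ j, stepWeight q (r j) := by
    rw [← mul_prod_erase univ _ (mem_univ i), Function.update_self,
      ← mul_prod_erase univ (fun j => stepWeight q (r j)) (mem_univ i), hri, stepWeight_zero,
      one_mul]
    congr 1
    refine prod_congr rfl fun j hj => ?_
    rw [Function.update_of_ne (ne_of_mem_erase hj)]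
  have h2 : ∀ t, (e fun j => (Function.update r i s j t : ℤ)) =
      (e fun j => (r j t : ℤ)) + ((s t : ℤ) ^ 2 - s t * (nbrRow A i r t : ℤ)) := fun t => by
    have h3 : (fun j => (Function.update r i s j t : ℤ)) =
        Function.update (fun j => (r j t : ℤ)) i (s t : ℤ) := by
      funext j
      by_cases h : j = i
      · subst h; simp
      · simp [Function.update_of_ne h]
    have h4 : Function.update (fun j => (r j t : ℤ)) i 0 = fun j => (r j t : ℤ) := by
      rw [Function.update_eq_self_iff, hri]
      simp
    rw [h3, he, h4]
    simp only [nbrRow]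
    push_cast
    ring
  unfold tupleWeight
  rw [h1, finsum_congr h2, finsum_add_distrib, zpow_add₀ hq0]
  · ring
  · refine finite_support_tuple hr fun t ht => ?_
    rw [show (fun i => (r i t : ℤ)) = 0 from funext fun i => by simp [ht i], he0]
  · exact hs.finite_support_of fun t ht => by simp [ht]

theorem sum_piFinset_descending {M : Type*} [AddCommMonoid M] (d : σ →₀ ℕ) (i : σ)
    (F : (σ → ℕ → ℕ) → M) :
    ∑ r ∈ Fintype.piFinset (fun j => descending (d j)), F r =
      ∑ r ∈ Fintype.piFinset (fun j => descending (setCoord d i 0 j)),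
        ∑ s ∈ descending (d i), F (Function.update r i s) := by
  rw [← sum_product']
  refine sum_bij' (fun r _ => (Function.update r i 0, r i))
    (fun p _ => Function.update p.1 i p.2) ?_ ?_ ?_ ?_ ?_
  · intro r hr
    rw [Fintype.mem_piFinset] at hr
    rw [mem_product, Fintype.mem_piFinset]
    refine ⟨fun j => ?_, hr i⟩
    by_cases h : j = i
    · subst h; simp [setCoord_same, descending_zero]
    · rw [setCoord_of_ne _ _ h]
      simpa [Function.update_of_ne h] using hr j
  · rintro ⟨r, s⟩ hp
    rw [mem_product, Fintype.mem_piFinset] at hp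
    rw [Fintype.mem_piFinset]
    intro j
    by_cases h : j = i
    · subst h; simpa using hp.2
    · have := hp.1 j
      rw [setCoord_of_ne _ _ h] at this
      rwa [Function.update_of_ne h]
  · intro r hr
    simp
  · rintro ⟨r, s⟩ hp
    rw [mem_product, Fintype.mem_piFinset] at hp
    have := hp.1 i
    rw [setCoord_same, descending_zero, mem_singleton] at this
    simp only [Function.update_idem, Function.update_self, Prod.mk.injEq,
      Function.update_eq_self_iff, and_true]
    exact this.symm
  · intro r hr
    simp

/-- The generating function with the contribution of the vertex `i` normalised. -/
noncomputable def twistSum (q : K) (e : (σ → ℤ) → ℤ) (A : σ → σ → ℕ) (i : σ) :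
    MvPowerSeries σ K :=
  fun d => ∑ r ∈ Fintype.piFinset (fun j => descending (setCoord d i 0 j)),
    tupleWeight q e r * PowerSeries.coeff (d i) (twist q fun t => (nbrRow A i r t : ℤ))

theorem coeff_twistSum (q : K) (e : (σ → ℤ) → ℤ) (A : σ → σ → ℕ) (i : σ) (d : σ →₀ ℕ) :
    MvPowerSeries.coeff d (twistSum q e A i) =
      ∑ r ∈ Fintype.piFinset (fun j => descending (setCoord d i 0 j)),
        tupleWeight q e r * PowerSeries.coeff (d i) (twist q fun t => (nbrRow A i r t : ℤ)) := rfl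

theorem quiverSum_eq_mul_twistSum {q : K} (hq0 : q ≠ 0) {e : (σ → ℤ) → ℤ} (he0 : e 0 = 0)
    {A : σ → σ → ℕ} {i : σ}
    (he : ∀ v x, e (Function.update v i x) =
      e (Function.update v i 0) + x ^ 2 - x * ∑ j, (A i j : ℤ) * v j) :
    quiverSum q e = substMonomial (Finsupp.single i 1) (vertexSum q 0) * twistSum q e A i := by
  ext d
  rw [coeff_substMonomial_single_mul, coeff_quiverSum,
    sum_piFinset_descending d i (tupleWeight q e)]
  simp only [coeff_twistSum, setCoord_setCoord, setCoord_same, mul_sum]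
  refine Eq.trans (sum_congr rfl fun r hr => ?_) sum_comm
  rw [Fintype.mem_piFinset] at hr
  have hri : r i = 0 := by
    have := hr i
    rwa [setCoord_same, descending_zero, mem_singleton] at this
  have hrd : ∀ j, IsDescending (r j) := fun j => (mem_descending.mp (hr j)).1
  have h1 := congrArg (PowerSeries.coeff (d i))
    (vertexSum_eq_mul_twist q fun t => (nbrRow A i r t : ℤ))
  rw [PowerSeries.coeff_mul, coeff_vertexSum] at h1
  have h2 : ∀ s ∈ descending (d i), tupleWeight q e (Function.update r i s) =
      tupleWeight q e r * (stepWeight q s *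
        q ^ (∑ᶠ t, ((s t : ℤ) ^ 2 - s t * (nbrRow A i r t : ℤ)))) := fun s hs =>
    tupleWeight_update hq0 he0 he hrd hri (mem_descending.mp hs).1
  rw [sum_congr rfl h2, ← mul_sum, h1, mul_sum]
  exact sum_congr rfl fun p _ => by ring

theorem isReflection_twistSum [CharZero K] {q : K} (hq0 : q ≠ 0) (hq : ∀ n, q ^ (n + 1) ≠ 1)
    (e : (σ → ℤ) → ℤ) {A : σ → σ → ℕ} {i : σ} (hA : A i i = 0) :
    IsReflection A i (twistSum q e A i) (twistSum q e A i) := by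
  have hpal : ∀ (d : σ →₀ ℕ), ∀ r ∈ Fintype.piFinset (fun j => descending (setCoord d i 0 j)),
      IsPalindromic (nbr A i d : ℤ) (twist q fun t => (nbrRow A i r t : ℤ)) := by
    intro d r hr
    rw [Fintype.mem_piFinset] at hr
    have h1 : IsDescending (nbrRow A i r) :=
      IsDescending.sum_mul univ (A i) fun j _ => (mem_descending.mp (hr j)).1
    have h2 := isPalindromic_twist hq0 hq h1
    rwa [finsum_nbrRow hr, nbr_setCoord hA] at h2
  have hz : ∀ d : σ →₀ ℕ, ¬ d i ≤ nbr A i d →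
      MvPowerSeries.coeff d (twistSum q e A i) = 0 := by
    intro d hd
    rw [coeff_twistSum]
    refine sum_eq_zero fun r hr => ?_
    rw [← icoeff_natCast, hpal d r hr, icoeff_of_neg _ (by omega), mul_zero]
  refine ⟨fun d hd => ?_, hz, hz⟩
  rw [coeff_twistSum, coeff_twistSum]
  simp only [reflect, setCoord_setCoord, setCoord_same]
  refine sum_congr rfl fun r hr => ?_
  rw [← icoeff_natCast, hpal d r hr, ← icoeff_natCast, Nat.cast_sub hd]

/-- The generating function factors over the roots of a root system with the
given simple reflections. -/
theorem quiverSum_eq_prod [CharZero K] {q : K} (hq0 : q ≠ 0) (hq : ∀ n, q ^ (n + 1) ≠ 1)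
    {e : (σ → ℤ) → ℤ} (he0 : e 0 = 0) {A : σ → σ → ℕ} (hA : ∀ i, A i i = 0)
    (he : ∀ i v x, e (Function.update v i x) =
      e (Function.update v i 0) + x ^ 2 - x * ∑ j, (A i j : ℤ) * v j)
    (hpos : ∀ d : σ →₀ ℕ, d ≠ 0 → ∃ i, nbr A i d < 2 * d i)
    (Φ : Finset (σ →₀ ℕ)) (hΦ0 : 0 ∉ Φ) (hΦs : ∀ i, Finsupp.single i 1 ∈ Φ)
    (hΦ : ∀ i, ∀ α ∈ Φ, α ≠ Finsupp.single i 1 → α i ≤ nbr A i α ∧ reflect A i α ∈ Φ) :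
    quiverSum q e = ∏ α ∈ Φ, substMonomial α (vertexSum q 0) := by
  have hne : ∀ α ∈ Φ, α ≠ 0 := fun α hα h => hΦ0 (h ▸ hα)
  have hinv : ∀ α ∈ Φ, substMonomial α (vertexSum q 0) * substMonomial α (vertexSum q 0)⁻¹ = 1 :=
    fun α hα => by
      rw [← substMonomial_mul (hne α hα), vertexSum_zero_mul_inv, substMonomial_one (hne α hα)]
  have hT : quiverSum q e * ∏ α ∈ Φ, substMonomial α (vertexSum q 0)⁻¹ = 1 := by
    refine eq_one_of_isReflection (A := A) hA ?_ (fun i => ?_) hpos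
    · have h1 : MvPowerSeries.coeff 0 (quiverSum q e) = 1 := by
        rw [coeff_quiverSum]
        simp only [Finsupp.coe_zero, Pi.zero_apply, descending_zero, Fintype.piFinset_singleton,
          sum_singleton, tupleWeight]
        have h2 : (e fun _ : σ => ((0 : ℕ) : ℤ)) = 0 := by
          rw [← he0]
          congr 1
        rw [h2]
        simp [stepWeight_zero]
      have h2 : ∀ α ∈ Φ, MvPowerSeries.constantCoeff
          (substMonomial α (vertexSum q 0)⁻¹ : MvPowerSeries σ K) = 1 := fun α hα => by
        have h4 := coeff_nsmul_substMonomial (hne α hα) (vertexSum q 0)⁻¹ 0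
        rw [zero_smul] at h4
        rw [← MvPowerSeries.coeff_zero_eq_constantCoeff_apply, h4,
          PowerSeries.coeff_zero_eq_constantCoeff_apply, PowerSeries.constantCoeff_inv,
          constantCoeff_vertexSum, inv_one]
      rw [MvPowerSeries.coeff_zero_eq_constantCoeff_apply] at h1 ⊢
      rw [map_mul, map_prod, h1, prod_congr rfl h2]
      simp
    · have h1 : quiverSum q e * ∏ α ∈ Φ, substMonomial α (vertexSum q 0)⁻¹ =
          twistSum q e A i *
            ∏ α ∈ Φ.erase (Finsupp.single i 1), substMonomial α (vertexSum q 0)⁻¹ := by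
        rw [quiverSum_eq_mul_twistSum hq0 he0 (he i), ← mul_prod_erase Φ _ (hΦs i)]
        have := hinv _ (hΦs i)
        linear_combination (twistSum q e A i *
          ∏ α ∈ Φ.erase (Finsupp.single i 1), substMonomial α (vertexSum q 0)⁻¹) * this
      rw [h1]
      refine (isReflection_twistSum hq0 hq e (hA i)).mul (hA i) ?_
      have hmaps : ∀ α ∈ Φ.erase (Finsupp.single i 1),
          reflect A i α ∈ Φ.erase (Finsupp.single i 1) := by
        intro α hα
        obtain ⟨ha, hα⟩ := mem_erase.mp hα
        obtain ⟨h2, h3⟩ := hΦ i α hα ha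
        refine mem_erase.mpr ⟨fun h => ?_, h3⟩
        have h4 := reflect_mem_cone (hA i) α
        have h5 : nbr A i (Finsupp.single i 1) = 0 := by
          refine sum_eq_zero fun j _ => ?_
          by_cases hj : j = i
          · subst hj; simp [hA]
          · simp [Ne.symm hj]
        rw [h, h5] at h4
        simp at h4
      have h6 : ∏ α ∈ Φ.erase (Finsupp.single i 1),
            (substMonomial α (vertexSum q 0)⁻¹ : MvPowerSeries σ K) =
          ∏ α ∈ Φ.erase (Finsupp.single i 1),
            substMonomial (reflect A i α) (vertexSum q 0)⁻¹ := by
        have hrr : ∀ α ∈ Φ.erase (Finsupp.single i 1), reflect A i (reflect A i α) = α :=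
          fun α hα => reflect_reflect (hA i)
            (hΦ i α (mem_of_mem_erase hα) (ne_of_mem_erase hα)).1
        refine prod_bij' (fun α _ => reflect A i α) (fun α _ => reflect A i α) hmaps hmaps hrr hrr
          fun α hα => ?_
        rw [hrr α hα]
      have h7 := IsReflection.prod (hA i) (Φ.erase (Finsupp.single i 1))
        (F := fun α => substMonomial α (vertexSum q 0)⁻¹)
        (G := fun α => substMonomial (reflect A i α) (vertexSum q 0)⁻¹)
        (fun α hα => isReflection_substMonomial (hA i) (hne α (mem_of_mem_erase hα))
          (hΦ i α (mem_of_mem_erase hα) (ne_of_mem_erase hα)).1 _)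
      rwa [← h6] at h7
  have h8 : (∏ α ∈ Φ, substMonomial α (vertexSum q 0)) *
      ∏ α ∈ Φ, substMonomial α (vertexSum q 0)⁻¹ = (1 : MvPowerSeries σ K) := by
    rw [← prod_mul_distrib, prod_congr rfl hinv, prod_const_one]
  linear_combination (∏ α ∈ Φ, substMonomial α (vertexSum q 0)) * hT - quiverSum q e * h8

end QuiverSum

section TypeD

open Finset PowerSeries

/-- The sum of the neighbours of `p` in the diagram of type `D_l`. -/
def nbrD {M : Type*} [AddCommMonoid M] (l : ℕ) (w : ℕ → M) (p : ℕ) : M :=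
  (if 2 ≤ p ∧ p ≤ l - 1 then w (p - 1) else 0) + (if p = l then w (l - 2) else 0) +
    (if p ≤ l - 2 then w (p + 1) else 0) + (if p = l - 2 then w l else 0)

/-- Positive roots of type `D_l` in simple root coordinates. -/
def IsRootD (l : ℕ) (c : ℕ → ℕ) : Prop :=
  (∃ i j, 1 ≤ i ∧ i ≤ j ∧ j ≤ l - 1 ∧
      c = fun s => if i ≤ s ∧ s ≤ j then 1 else 0)
    ∨ (∃ i, 1 ≤ i ∧ i ≤ l - 2 ∧
      c = fun s => (if i ≤ s ∧ s ≤ l - 2 then 1 else 0) + (if s = l then 1 else 0))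
    ∨ (c = fun s => if s = l then 1 else 0)
    ∨ (∃ i j, 1 ≤ i ∧ i < j ∧ j ≤ l - 1 ∧
      c = fun s => (if i ≤ s ∧ s ≤ j - 1 then 1 else 0)
        + (if j ≤ s ∧ s ≤ l - 2 then 2 else 0)
        + (if s = l - 1 ∨ s = l then 1 else 0))

theorem isRootD_chain {l i j : ℕ} (hi : 1 ≤ i) (hij : i ≤ j) (hj : j ≤ l - 1) :
    IsRootD l fun s => if i ≤ s ∧ s ≤ j then 1 else 0 := Or.inl ⟨i, j, hi, hij, hj, rfl⟩

theorem isRootD_fork {l i : ℕ} (hi : 1 ≤ i) (hil : i ≤ l - 2) :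
    IsRootD l fun s => (if i ≤ s ∧ s ≤ l - 2 then 1 else 0) + (if s = l then 1 else 0) :=
  Or.inr (Or.inl ⟨i, hi, hil, rfl⟩)

theorem isRootD_last {l : ℕ} : IsRootD l fun s => if s = l then 1 else 0 :=
  Or.inr (Or.inr (Or.inl rfl))

theorem isRootD_double {l i j : ℕ} (hi : 1 ≤ i) (hij : i < j) (hj : j ≤ l - 1) :
    IsRootD l fun s => (if i ≤ s ∧ s ≤ j - 1 then 1 else 0)
        + (if j ≤ s ∧ s ≤ l - 2 then 2 else 0) + (if s = l - 1 ∨ s = l then 1 else 0) :=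
  Or.inr (Or.inr (Or.inr ⟨i, j, hi, hij, hj, rfl⟩))

theorem nbrD_of_lt {l p : ℕ} {c : ℕ → ℕ} (hc : c 0 = 0) (hp : 1 ≤ p) (hpl : p < l - 2) :
    nbrD l c p = c (p - 1) + c (p + 1) := by
  have h1 : p ≠ l := by omega
  have h2 : p ≠ l - 2 := by omega
  have h3 : p ≤ l - 2 := by omega
  by_cases h : 2 ≤ p
  · simp [nbrD, h1, h2, h3, h, show p ≤ l - 1 by omega]
  · obtain rfl : p = 1 := by omega
    simp [nbrD, h1, h2, h3, hc]

theorem nbrD_branch {l p : ℕ} {c : ℕ → ℕ} (hl : 3 ≤ l) (hc : c 0 = 0) (hpl : p = l - 2) :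
    nbrD l c p = c (l - 3) + c (l - 1) + c l := by
  subst hpl
  have h1 : l - 2 ≠ l := by omega
  have h2 : l - 2 + 1 = l - 1 := by omega
  by_cases h : 2 ≤ l - 2
  · simp [nbrD, h1, h2, h, show l - 2 ≤ l - 1 by omega, show l - 2 - 1 = l - 3 by omega]
  · obtain rfl : l = 3 := by omega
    simp [nbrD, hc]

theorem nbrD_pred {l p : ℕ} {c : ℕ → ℕ} (hl : 3 ≤ l) (hpl : p = l - 1) :
    nbrD l c p = c (l - 2) := by
  subst hpl
  simp [nbrD, show l - 1 ≠ l by omega, show 2 ≤ l - 1 by omega, show l - 1 - 1 = l - 2 by omega,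
    show ¬ l - 1 ≤ l - 2 by omega, show l - 1 ≠ l - 2 by omega]

theorem nbrD_last {l p : ℕ} {c : ℕ → ℕ} (hl : 3 ≤ l) (hpl : p = l) :
    nbrD l c p = c (l - 2) := by
  subst hpl
  simp [nbrD, show ¬ p ≤ p - 1 by omega, show ¬ p ≤ p - 2 by omega, show p ≠ p - 2 by omega]

theorem nbrD_eq {l p : ℕ} {c : ℕ → ℕ} (hl : 3 ≤ l) (hc : c 0 = 0) (hp : 1 ≤ p) (hpl : p ≤ l) :
    (p < l - 2 ∧ nbrD l c p = c (p - 1) + c (p + 1)) ∨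
    (p = l - 2 ∧ nbrD l c p = c (l - 3) + c (l - 1) + c l) ∨
    (p = l - 1 ∧ nbrD l c p = c (l - 2)) ∨ (p = l ∧ nbrD l c p = c (l - 2)) := by
  rcases lt_trichotomy p (l - 2) with h | h | h
  · exact Or.inl ⟨h, nbrD_of_lt hc hp h⟩
  · exact Or.inr (Or.inl ⟨h, nbrD_branch hl hc h⟩)
  · by_cases h' : p = l
    · exact Or.inr (Or.inr (Or.inr ⟨h', nbrD_last hl h'⟩))
    · have h' : p = l - 1 := by omega
      exact Or.inr (Or.inr (Or.inl ⟨h', nbrD_pred hl h'⟩))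

theorem IsRootD.exists_reflect_chain {l i j p : ℕ} (hl : 3 ≤ l) (hi : 1 ≤ i) (hij : i ≤ j)
    (hj : j ≤ l - 1) (hp : 1 ≤ p) (hpl : p ≤ l) (hne : ¬ (i = p ∧ j = p))
    (c : ℕ → ℕ) (hc : c = fun s => if i ≤ s ∧ s ≤ j then 1 else 0) :
    ∃ c', IsRootD l c' ∧ (∀ s, s ≠ p → c' s = c s) ∧ c p + c' p = nbrD l c p := by
  have hn := nbrD_eq (c := c) hl (by simp [hc]; omega) hp hpl
  have hroot : IsRootD l c := hc ▸ isRootD_chain hi hij hj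
  replace hc : ∀ s, c s = if i ≤ s ∧ s ≤ j then 1 else 0 := fun s => by rw [hc]
  by_cases h1 : p = l
  · by_cases h2 : j = l - 2
    · refine ⟨_, isRootD_fork hi (by omega), ?_, ?_⟩
      · grind
      · grind
    · by_cases h3 : j = l - 1 ∧ i ≤ l - 2
      · refine ⟨_, isRootD_double (j := l - 1) hi (by omega) le_rfl, ?_, ?_⟩
        · grind
        · grind
      · exact ⟨c, hroot, fun _ _ => rfl, by grind⟩
  · by_cases h2 : p = j + 1
    · refine ⟨_, isRootD_chain (j := j + 1) hi (by omega) (by omega), ?_, ?_⟩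
      · grind
      · grind
    · by_cases h3 : p = j
      · refine ⟨_, isRootD_chain (j := j - 1) hi (by omega) (by omega), ?_, ?_⟩
        · grind
        · grind
      · by_cases h4 : p + 1 = i
        · refine ⟨_, isRootD_chain (i := i - 1) (by omega) (by omega) hj, ?_, ?_⟩
          · grind
          · grind
        · by_cases h5 : p = i
          · refine ⟨_, isRootD_chain (i := i + 1) (by omega) (by omega) hj, ?_, ?_⟩
            · grind
            · grind
          · exact ⟨c, hroot, fun _ _ => rfl, by grind⟩

theorem IsRootD.exists_reflect_fork {l i p : ℕ} (hl : 3 ≤ l) (hi : 1 ≤ i) (hil : i ≤ l - 2)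
    (hp : 1 ≤ p) (hpl : p ≤ l) (c : ℕ → ℕ)
    (hc : c = fun s => (if i ≤ s ∧ s ≤ l - 2 then 1 else 0) + (if s = l then 1 else 0)) :
    ∃ c', IsRootD l c' ∧ (∀ s, s ≠ p → c' s = c s) ∧ c p + c' p = nbrD l c p := by
  have hn := nbrD_eq (c := c) hl (by simp [hc]; omega) hp hpl
  have hroot : IsRootD l c := hc ▸ isRootD_fork hi hil
  replace hc : ∀ s, c s = (if i ≤ s ∧ s ≤ l - 2 then 1 else 0) + (if s = l then 1 else 0) :=
    fun s => by rw [hc]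
  by_cases h1 : p = l
  · refine ⟨_, isRootD_chain (j := l - 2) hi hil (by omega), ?_, ?_⟩
    · grind
    · grind
  · by_cases h2 : p = l - 1
    · refine ⟨_, isRootD_double (j := l - 1) hi (by omega) le_rfl, ?_, ?_⟩
      · grind
      · grind
    · by_cases h4 : p + 1 = i
      · refine ⟨_, isRootD_fork (i := i - 1) (by omega) (by omega), ?_, ?_⟩
        · grind
        · grind
      · by_cases h5 : p = i
        · by_cases h6 : i = l - 2
          · refine ⟨_, isRootD_last, ?_, ?_⟩
            · grind
            · grind
          · refine ⟨_, isRootD_fork (i := i + 1) (by omega) (by omega), ?_, ?_⟩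
            · grind
            · grind
        · exact ⟨c, hroot, fun _ _ => rfl, by grind⟩

theorem IsRootD.exists_reflect_last {l p : ℕ} (hl : 3 ≤ l)
    (hp : 1 ≤ p) (hpl : p ≤ l) (hne : p ≠ l) (c : ℕ → ℕ)
    (hc : c = fun s => if s = l then 1 else 0) :
    ∃ c', IsRootD l c' ∧ (∀ s, s ≠ p → c' s = c s) ∧ c p + c' p = nbrD l c p := by
  have hn := nbrD_eq (c := c) hl (by simp [hc]; omega) hp hpl
  have hroot : IsRootD l c := hc ▸ isRootD_last
  replace hc : ∀ s, c s = if s = l then 1 else 0 := fun s => by rw [hc]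
  by_cases h1 : p = l - 2
  · refine ⟨_, isRootD_fork (i := l - 2) (by omega) le_rfl, ?_, ?_⟩
    · grind
    · grind
  · exact ⟨c, hroot, fun _ _ => rfl, by grind⟩

theorem IsRootD.exists_reflect_double {l i j p : ℕ} (hl : 3 ≤ l) (hi : 1 ≤ i) (hij : i < j)
    (hj : j ≤ l - 1) (hp : 1 ≤ p) (hpl : p ≤ l) (c : ℕ → ℕ)
    (hc : c = fun s => (if i ≤ s ∧ s ≤ j - 1 then 1 else 0)
        + (if j ≤ s ∧ s ≤ l - 2 then 2 else 0) + (if s = l - 1 ∨ s = l then 1 else 0)) :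
    ∃ c', IsRootD l c' ∧ (∀ s, s ≠ p → c' s = c s) ∧ c p + c' p = nbrD l c p := by
  have hn := nbrD_eq (c := c) hl (by simp [hc]; omega) hp hpl
  have hroot : IsRootD l c := hc ▸ isRootD_double hi hij hj
  replace hc : ∀ s, c s = (if i ≤ s ∧ s ≤ j - 1 then 1 else 0)
        + (if j ≤ s ∧ s ≤ l - 2 then 2 else 0) + (if s = l - 1 ∨ s = l then 1 else 0) :=
    fun s => by rw [hc]
  by_cases h1 : p = j
  · by_cases h2 : j = l - 1
    · refine ⟨_, isRootD_fork (i := i) hi (by omega), ?_, ?_⟩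
      · grind
      · grind
    · refine ⟨_, isRootD_double (j := j + 1) hi (by omega) (by omega), ?_, ?_⟩
      · grind
      · grind
  · by_cases h2 : p = l ∧ j = l - 1
    · refine ⟨_, isRootD_chain (j := l - 1) hi (by omega) le_rfl, ?_, ?_⟩
      · grind
      · grind
    · by_cases h3 : p + 1 = i
      · refine ⟨_, isRootD_double (i := i - 1) (by omega) (by omega) hj, ?_, ?_⟩
        · grind
        · grind
      · by_cases h4 : p = i ∧ i + 1 < j
        · refine ⟨_, isRootD_double (i := i + 1) (by omega) (by omega) hj, ?_, ?_⟩
          · grind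
          · grind
        · by_cases h5 : p + 1 = j ∧ i < p
          · refine ⟨_, isRootD_double (j := j - 1) hi (by omega) (by omega), ?_, ?_⟩
            · grind
            · grind
          · refine ⟨c, hroot, fun _ _ => rfl, ?_⟩
            clear hroot
            rcases hn with ⟨h6, hn⟩ | ⟨h6, hn⟩ | ⟨h6, hn⟩ | ⟨h6, hn⟩
            · rcases lt_or_ge p j with h7 | h7
              · have h8 : j ≤ l - 2 ∨ j = l - 1 := by omega
                have h9 : p < i ∨ p = i ∨ i < p := by omega
                grind (splits := 20)
              · grind
            · rcases lt_or_ge p j with h7 | h7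
              · grind (splits := 20)
              · grind
            · grind
            · grind

theorem IsRootD.exists_reflect {l p : ℕ} (hl : 3 ≤ l) (hp : 1 ≤ p) (hpl : p ≤ l) {c : ℕ → ℕ}
    (hc : IsRootD l c) (hne : c ≠ fun s => if s = p then 1 else 0) :
    ∃ c', IsRootD l c' ∧ (∀ s, s ≠ p → c' s = c s) ∧ c p + c' p = nbrD l c p := by
  rcases hc with ⟨i, j, hi, hij, hj, hc⟩ | ⟨i, hi, hil, hc⟩ | hc | ⟨i, j, hi, hij, hj, hc⟩
  · refine IsRootD.exists_reflect_chain hl hi hij hj hp hpl ?_ c hc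
    rintro ⟨rfl, rfl⟩
    refine hne (hc.trans ?_)
    funext s
    exact if_congr (by omega) rfl rfl
  · exact IsRootD.exists_reflect_fork hl hi hil hp hpl c hc
  · refine IsRootD.exists_reflect_last hl hp hpl ?_ c hc
    rintro rfl
    exact hne hc
  · exact IsRootD.exists_reflect_double hl hi hij hj hp hpl c hc

theorem exists_nbrD_lt {l : ℕ} (hl : 3 ≤ l) {c : ℕ → ℕ} (hc : ∀ s, s ∉ Icc 1 l → c s = 0)
    (hc0 : c ≠ 0) : ∃ p, 1 ≤ p ∧ p ≤ l ∧ nbrD l c p < 2 * c p := by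
  by_contra! hcon
  have h0 : c 0 = 0 := hc 0 (by simp)
  have hstep : ∀ p, p < l - 2 → c p < c (p + 1) ∨ (c p = 0 ∧ c (p + 1) = 0) := by
    intro p
    induction p with
    | zero => intro _; omega
    | succ p ih =>
      intro hp
      have h1 := ih (by omega)
      have h2 := hcon (p + 1) (by omega) (by omega)
      rw [nbrD_of_lt h0 (by omega) hp, Nat.add_sub_cancel] at h2
      omega
  have h1 := hcon (l - 2) (by omega) (by omega)
  have h2 := hcon (l - 1) (by omega) (by omega)
  have h3 := hcon l (by omega) le_rfl
  rw [nbrD_branch hl h0 rfl] at h1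
  rw [nbrD_pred hl rfl] at h2
  rw [nbrD_last hl rfl] at h3
  have h4 := hstep (l - 3) (by omega)
  rw [show l - 3 + 1 = l - 2 by omega] at h4
  have h5 : ∀ k, c (l - 2 - k) = 0 := by
    intro k
    induction k with
    | zero => rw [Nat.sub_zero]; omega
    | succ k ih =>
      by_cases hk : k < l - 2
      · have h6 := hstep (l - 2 - (k + 1)) (by omega)
        rw [show l - 2 - (k + 1) + 1 = l - 2 - k by omega] at h6
        omega
      · rw [show l - 2 - (k + 1) = 0 by omega, h0]
  refine hc0 (funext fun s => ?_)
  by_cases hs : s ≤ l - 2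
  · have := h5 (l - 2 - s)
    rwa [show l - 2 - (l - 2 - s) = s by omega] at this
  · have h7 := h5 0
    rw [Nat.sub_zero] at h7
    by_cases hs1 : s = l - 1
    · subst hs1; simp; omega
    · by_cases hs2 : s = l
      · subst hs2; simp; omega
      · exact hc s (by simp; omega)

end TypeD

section FormD

open Finset PowerSeries

/-- Extension of a vector indexed by `Fin l` to `ℕ`, placed in positions `1, …, l`. -/
def extD {M : Type*} [Zero M] {l : ℕ} (v : Fin l → M) (s : ℕ) : M :=
  if h : 1 ≤ s ∧ s ≤ l then v ⟨s - 1, by omega⟩ else 0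

@[simp]
theorem extD_val_succ {M : Type*} [Zero M] {l : ℕ} (v : Fin l → M) (i : Fin l) :
    extD v (i + 1) = v i := by
  have : 1 ≤ (i : ℕ) + 1 ∧ (i : ℕ) + 1 ≤ l := by omega
  simp [extD]

theorem extD_of_notMem {M : Type*} [Zero M] {l s : ℕ} (v : Fin l → M) (h : s ∉ Icc 1 l) :
    extD v s = 0 := by
  rw [mem_Icc] at h
  simp [extD, h]

theorem exists_val_succ_eq {l s : ℕ} (hs : s ∈ Icc 1 l) : ∃ i : Fin l, (i : ℕ) + 1 = s := by
  rw [mem_Icc] at hs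
  exact ⟨⟨s - 1, by omega⟩, by simp; omega⟩

theorem prod_Icc_eq_prod_fin {M : Type*} [CommMonoid M] (l : ℕ) (f : ℕ → M) :
    ∏ s ∈ Icc 1 l, f s = ∏ i : Fin l, f (i + 1) := by
  rw [Fin.prod_univ_eq_prod_range (fun i => f (i + 1)) l, Finset.range_eq_Ico,
    Finset.prod_Ico_add' f 0 l 1]
  rfl

theorem extD_restrict {M : Type*} [Zero M] {l : ℕ} {w : ℕ → M}
    (hw : ∀ s, s ∉ Icc 1 l → w s = 0) : extD (fun i : Fin l => w (i + 1)) = w := by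
  funext s
  by_cases hs : s ∈ Icc 1 l
  · obtain ⟨i, rfl⟩ := exists_val_succ_eq hs
    simp
  · rw [extD_of_notMem _ hs, hw s hs]

theorem extD_update {M : Type*} [Zero M] {l : ℕ} (v : Fin l → M) (i : Fin l) (x : M) :
    extD (Function.update v i x) = Function.update (extD v) (i + 1) x := by
  funext s
  by_cases hs : s ∈ Icc 1 l
  · obtain ⟨j, rfl⟩ := exists_val_succ_eq hs
    simp [Function.update_apply, Fin.ext_iff]
  · have : s ≠ i + 1 := by rintro rfl; simp at hs
    rw [extD_of_notMem _ hs, Function.update_of_ne this, extD_of_notMem _ hs]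

/-- The adjacency matrix of the diagram of type `D_l`. -/
def adjD (l : ℕ) (i j : Fin l) : ℕ := nbrD l (fun s => if s = j + 1 then 1 else 0) (i + 1)

theorem sum_adjD_mul {M : Type*} [CommSemiring M] {l : ℕ} (v : Fin l → M) (i : Fin l) :
    ∑ j, (adjD l i j : M) * v j = nbrD l (extD v) (i + 1) := by
  have h : ∀ s, extD v s = ∑ j : Fin l, (if s = j + 1 then 1 else 0) * v j := by
    intro s
    by_cases hs : s ∈ Icc 1 l
    · obtain ⟨j, rfl⟩ := exists_val_succ_eq hs
      simp [Fin.val_inj]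
    · rw [extD_of_notMem _ hs, Finset.sum_eq_zero]
      intro j _
      rw [if_neg, zero_mul]
      rintro rfl
      simp at hs
  simp only [adjD, nbrD, h, Nat.cast_add, add_mul, sum_add_distrib]
  congr 1
  · congr 1
    · congr 1
      · split_ifs <;> simp
      · split_ifs <;> simp
    · split_ifs <;> simp
  · split_ifs <;> simp

/-- The quadratic form of type `D_l`. -/
def formD (l : ℕ) (w : ℕ → ℤ) : ℤ :=
  ∑ i ∈ Icc 1 l, w i ^ 2 - ∑ i ∈ Icc 2 (l - 1), w (i - 1) * w i - w (l - 2) * w l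

theorem formD_update {l p : ℕ} (hl : 3 ≤ l) (hp : 1 ≤ p) (hpl : p ≤ l) (w : ℕ → ℤ) (x : ℤ) :
    formD l (Function.update w p x) =
      formD l (Function.update w p 0) + x ^ 2 - x * nbrD l w p := by
  have h1 : ∑ i ∈ Icc 1 l, Function.update w p x i ^ 2 =
      ∑ i ∈ Icc 1 l, Function.update w p 0 i ^ 2 + x ^ 2 := by
    have : ∀ i ∈ Icc 1 l, Function.update w p x i ^ 2 =
        Function.update w p 0 i ^ 2 + if i = p then x ^ 2 else 0 := by
      intro i _
      by_cases h : i = p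
      · subst h; simp
      · simp [h]
    rw [sum_congr rfl this, sum_add_distrib, sum_ite_eq', if_pos (mem_Icc.2 ⟨hp, hpl⟩)]
  have h2 : ∑ i ∈ Icc 2 (l - 1), Function.update w p x (i - 1) * Function.update w p x i =
      ∑ i ∈ Icc 2 (l - 1), Function.update w p 0 (i - 1) * Function.update w p 0 i +
        x * ((if 2 ≤ p ∧ p ≤ l - 1 then w (p - 1) else 0) +
          (if p ≤ l - 2 then w (p + 1) else 0)) := by
    have : ∀ i ∈ Icc 2 (l - 1), Function.update w p x (i - 1) * Function.update w p x i =
        Function.update w p 0 (i - 1) * Function.update w p 0 i +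
          ((if i = p then x * w (p - 1) else 0) + if i = p + 1 then x * w (p + 1) else 0) := by
      intro i hi
      rw [mem_Icc] at hi
      by_cases h : i = p
      · subst h
        have : i - 1 ≠ i := by omega
        simp [this, mul_comm]
      · by_cases h' : i = p + 1
        · subst h'
          simp
        · have : i - 1 ≠ p := by omega
          simp [h, h', this]
    rw [sum_congr rfl this, sum_add_distrib, sum_add_distrib, sum_ite_eq', sum_ite_eq', mul_add,
      mul_ite, mul_ite, mul_zero]
    simp only [mem_Icc]
    rw [if_congr (show 2 ≤ p + 1 ∧ p + 1 ≤ l - 1 ↔ p ≤ l - 2 by omega) rfl rfl]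
  have h3 : Function.update w p x (l - 2) * Function.update w p x l =
      Function.update w p 0 (l - 2) * Function.update w p 0 l +
        x * ((if p = l then w (l - 2) else 0) + if p = l - 2 then w l else 0) := by
    by_cases h : p = l
    · subst h
      have h4 : p - 2 ≠ p := by omega
      simp [h4, h4.symm, mul_comm]
    · by_cases h' : p = l - 2
      · subst h'
        simp [h, Ne.symm h]
      · simp [h, h', Ne.symm h, Ne.symm h']
  rw [formD, formD, h1, h2, h3, nbrD]
  ring

theorem formD_nonneg {l : ℕ} (hl : 3 ≤ l) (w : ℕ → ℤ) : 0 ≤ formD l w := by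
  have key : ∀ k, w (k + 1) ^ 2 ≤
      2 * (∑ i ∈ Icc 1 (k + 1), w i ^ 2 - ∑ i ∈ Icc 2 (k + 1), w (i - 1) * w i) := by
    intro k
    induction k with
    | zero => simp; nlinarith [sq_nonneg (w 1)]
    | succ k ih =>
      rw [sum_Icc_succ_top (by omega), sum_Icc_succ_top (a := 2) (by omega), Nat.add_sub_cancel]
      nlinarith [sq_nonneg (w (k + 1) - w (k + 1 + 1))]
  obtain ⟨k, rfl⟩ : ∃ k, l = k + 3 := ⟨l - 3, by omega⟩
  have h := key k
  rw [formD, show k + 3 - 1 = k + 1 + 1 by omega, show k + 3 - 2 = k + 1 by omega,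
    sum_Icc_succ_top (by omega), sum_Icc_succ_top (b := k + 1) (by omega),
    sum_Icc_succ_top (a := 2) (by omega), Nat.add_sub_cancel]
  nlinarith [sq_nonneg (2 * w (k + 1 + 1) - w (k + 1)), sq_nonneg (2 * w (k + 2 + 1) - w (k + 1))]

/-- Restriction of a vector indexed by `ℕ` to the positions `1, …, l`. -/
noncomputable def resD (l : ℕ) (c : ℕ → ℕ) : Fin l →₀ ℕ :=
  Finsupp.equivFunOnFinite.symm fun i => c (i + 1)

@[simp]
theorem resD_apply (l : ℕ) (c : ℕ → ℕ) (i : Fin l) : resD l c i = c (i + 1) := rfl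

theorem IsRootD.eq_zero_of_notMem {l : ℕ} (hl : 3 ≤ l) {c : ℕ → ℕ} (hc : IsRootD l c) :
    ∀ s, s ∉ Icc 1 l → c s = 0 := by
  intro s hs
  rw [mem_Icc] at hs
  rcases hc with ⟨i, j, hi, hij, hj, rfl⟩ | ⟨i, hi, hil, rfl⟩ | rfl | ⟨i, j, hi, hij, hj, rfl⟩
  · grind
  · grind
  · grind
  · grind

theorem IsRootD.ne_zero {l : ℕ} {c : ℕ → ℕ} (hc : IsRootD l c) : c ≠ 0 := by
  intro h
  rcases hc with ⟨i, j, hi, hij, hj, rfl⟩ | ⟨i, hi, hil, rfl⟩ | rfl | ⟨i, j, hi, hij, hj, rfl⟩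
  · have := congrFun h i
    simp [hij] at this
  · have := congrFun h l
    simp at this
  · have := congrFun h l
    simp at this
  · have := congrFun h l
    simp at this

theorem isRootD_simple {l p : ℕ} (hp : 1 ≤ p) (hpl : p ≤ l) :
    IsRootD l fun s => if s = p then 1 else 0 := by
  by_cases h : p = l
  · subst h
    exact isRootD_last
  · convert isRootD_chain hp (le_refl p) (show p ≤ l - 1 by omega) using 4
    omega

theorem resD_ne_zero {l : ℕ} (hl : 3 ≤ l) {c : ℕ → ℕ} (hc : IsRootD l c) : resD l c ≠ 0 := by
  intro h
  refine hc.ne_zero ?_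
  rw [← extD_restrict (hc.eq_zero_of_notMem hl)]
  funext s
  have : (fun i : Fin l => c (i + 1)) = 0 := funext fun i => DFunLike.congr_fun h i
  rw [this]
  simp [extD]

theorem resD_injOn {l : ℕ} (hl : 3 ≤ l) : Set.InjOn (resD l) {c | IsRootD l c} := by
  intro c hc c' hc' h
  rw [← extD_restrict (hc.eq_zero_of_notMem hl), ← extD_restrict (hc'.eq_zero_of_notMem hl)]
  congr 1
  funext i
  exact DFunLike.congr_fun h i

theorem nbr_adjD {l : ℕ} (d : Fin l →₀ ℕ) (i : Fin l) :
    nbr (adjD l) i d = nbrD l (extD d) (i + 1) := by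
  rw [← sum_adjD_mul]
  rfl

/-- The type `D_l` product formula over a field. -/
theorem quiverSum_formD {K : Type*} [Field K] [CharZero K] {q : K} (hq0 : q ≠ 0)
    (hq : ∀ n, q ^ (n + 1) ≠ 1) {l : ℕ} (hl : 3 ≤ l) {Φ : Finset (ℕ → ℕ)}
    (hΦ : ∀ c, c ∈ Φ ↔ IsRootD l c) :
    quiverSum q (fun v : Fin l → ℤ => formD l (extD v)) =
      ∏ c ∈ Φ, substMonomial (resD l c) (vertexSum q 0) := by
  classical
  have hinj : Set.InjOn (resD l) (Φ : Set (ℕ → ℕ)) := fun c hc c' hc' h =>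
    resD_injOn hl ((hΦ c).1 hc) ((hΦ c').1 hc') h
  rw [← Finset.prod_image (f := fun α => substMonomial α (vertexSum q 0)) hinj]
  refine quiverSum_eq_prod hq0 hq ?_ (A := adjD l) ?_ ?_ ?_ _ ?_ ?_ ?_
  · have : extD (0 : Fin l → ℤ) = 0 := by
      funext s
      simp [extD]
    simp [this, formD]
  · intro i
    simp only [adjD, nbrD]
    have : (i : ℕ) < l := i.2
    grind
  · intro i v x
    rw [extD_update, extD_update, sum_adjD_mul, formD_update hl (by omega) (by omega)]
  · intro d hd
    have h0 : extD d ≠ 0 := by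
      intro h
      refine hd (Finsupp.ext fun i => ?_)
      rw [← extD_val_succ (fun i => d i) i]
      exact congrFun h _
    obtain ⟨p, hp, hpl, h⟩ := exists_nbrD_lt hl (fun s hs => extD_of_notMem _ hs) h0
    obtain ⟨i, rfl⟩ := exists_val_succ_eq (mem_Icc.2 ⟨hp, hpl⟩)
    refine ⟨i, ?_⟩
    rw [nbr_adjD]
    simpa using h
  · rw [mem_image]
    rintro ⟨c, hc, h⟩
    exact resD_ne_zero hl ((hΦ c).1 hc) h
  · intro i
    refine mem_image.2 ⟨_, (hΦ _).2 (isRootD_simple (p := i + 1) (by omega) (by omega)), ?_⟩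
    ext j
    simp [Finsupp.single_apply, Fin.val_inj, eq_comm]
  · intro i α hα hne
    obtain ⟨c, hc, rfl⟩ := mem_image.1 hα
    have hc' := (hΦ c).1 hc
    obtain ⟨c', hr, h1, h2⟩ := hc'.exists_reflect (p := i + 1) hl (by omega) (by omega) (by
      rintro rfl
      refine hne ?_
      ext j
      simp [Finsupp.single_apply, Fin.val_inj, eq_comm])
    have h3 : nbr (adjD l) i (resD l c) = c (i + 1) + c' (i + 1) := by
      rw [nbr_adjD, h2]
      exact congrArg (fun w => nbrD l w (i + 1)) (extD_restrict (hc'.eq_zero_of_notMem hl))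
    refine ⟨by rw [h3, resD_apply]; omega, mem_image.2 ⟨c', (hΦ c').2 hr, ?_⟩⟩
    ext j
    by_cases hj : j = i
    · subst hj
      rw [reflect_same, h3, resD_apply, resD_apply]
      omega
    · rw [reflect_of_ne _ hj, resD_apply, resD_apply, h1]
      simpa [Fin.val_inj] using hj

end FormD

section SplitFirst

open Finset PowerSeries

variable {R : Type*} [CommSemiring R] {l : ℕ}

theorem Finsupp.cons_add_cons (j k : ℕ) (d e : Fin l →₀ ℕ) :
    Finsupp.cons j d + Finsupp.cons k e = Finsupp.cons (j + k) (d + e) := by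
  ext i
  refine Fin.cases ?_ (fun i => ?_) i <;> simp

/-- The underlying function of `splitFirst`. -/
noncomputable def splitFirstFun (f : MvPowerSeries (Fin (l + 1)) R) :
    MvPowerSeries (Fin l) (PowerSeries R) :=
  fun d => PowerSeries.mk fun k => MvPowerSeries.coeff (Finsupp.cons k d) f

theorem coeff_coeff_splitFirstFun (f : MvPowerSeries (Fin (l + 1)) R) (k : ℕ)
    (d : Fin l →₀ ℕ) : PowerSeries.coeff k (MvPowerSeries.coeff d (splitFirstFun f)) =
      MvPowerSeries.coeff (Finsupp.cons k d) f := by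
  change PowerSeries.coeff k (PowerSeries.mk fun k => MvPowerSeries.coeff (Finsupp.cons k d) f) = _
  rw [PowerSeries.coeff_mk]

/-- The underlying function of the inverse of `splitFirst`. -/
noncomputable def joinFirst (g : MvPowerSeries (Fin l) (PowerSeries R)) :
    MvPowerSeries (Fin (l + 1)) R :=
  fun x => PowerSeries.coeff (x 0) (MvPowerSeries.coeff x.tail g)

theorem coeff_joinFirst (g : MvPowerSeries (Fin l) (PowerSeries R)) (x : Fin (l + 1) →₀ ℕ) :
    MvPowerSeries.coeff x (joinFirst g) =
      PowerSeries.coeff (x 0) (MvPowerSeries.coeff x.tail g) := rfl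

theorem splitFirstFun_mul (f g : MvPowerSeries (Fin (l + 1)) R) :
    splitFirstFun (f * g) = splitFirstFun f * splitFirstFun g := by
  ext d k
  rw [coeff_coeff_splitFirstFun, MvPowerSeries.coeff_mul, MvPowerSeries.coeff_mul, map_sum]
  simp only [PowerSeries.coeff_mul, coeff_coeff_splitFirstFun]
  rw [sum_sigma']
  refine sum_bij' (fun x _ => ⟨(x.1.tail, x.2.tail), (x.1 0, x.2 0)⟩)
    (fun y _ => (Finsupp.cons y.2.1 y.1.1, Finsupp.cons y.2.2 y.1.2)) ?_ ?_ ?_ ?_ ?_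
  · rintro ⟨a, b⟩ h
    rw [HasAntidiagonal.mem_antidiagonal] at h
    simp only [mem_sigma, HasAntidiagonal.mem_antidiagonal]
    constructor
    · ext i
      have := DFunLike.congr_fun h i.succ
      simpa [Finsupp.tail_apply] using this
    · have := DFunLike.congr_fun h 0
      simpa using this
  · rintro ⟨⟨a, b⟩, ⟨i, j⟩⟩ h
    simp only [mem_sigma, HasAntidiagonal.mem_antidiagonal] at h ⊢
    rw [Finsupp.cons_add_cons, h.1, h.2]
  · rintro ⟨a, b⟩ h
    simp [Finsupp.cons_tail]
  · rintro ⟨⟨a, b⟩, ⟨i, j⟩⟩ h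
    simp [Finsupp.tail_cons]
  · rintro ⟨a, b⟩ h
    simp [Finsupp.cons_tail]

/-- Power series in `l + 1` variables as power series in the last `l` variables whose
coefficients are power series in the first one. -/
noncomputable def splitFirst (R : Type*) [CommSemiring R] (l : ℕ) :
    MvPowerSeries (Fin (l + 1)) R ≃+* MvPowerSeries (Fin l) (PowerSeries R) where
  toFun := splitFirstFun
  invFun := joinFirst
  left_inv f := by
    ext x
    rw [coeff_joinFirst, coeff_coeff_splitFirstFun, Finsupp.cons_tail]
  right_inv g := by
    ext d k
    rw [coeff_coeff_splitFirstFun, coeff_joinFirst, Finsupp.cons_zero, Finsupp.tail_cons]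
  map_mul' := splitFirstFun_mul
  map_add' f g := by
    ext d k
    simp [coeff_coeff_splitFirstFun]

theorem coeff_coeff_splitFirst (f : MvPowerSeries (Fin (l + 1)) R) (k : ℕ) (d : Fin l →₀ ℕ) :
    PowerSeries.coeff k (MvPowerSeries.coeff d (splitFirst R l f)) =
      MvPowerSeries.coeff (Finsupp.cons k d) f :=
  coeff_coeff_splitFirstFun f k d

theorem coeff_splitFirst_symm (g : MvPowerSeries (Fin l) (PowerSeries R)) (x : Fin (l + 1) →₀ ℕ) :
    MvPowerSeries.coeff x ((splitFirst R l).symm g) =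
      PowerSeries.coeff (x 0) (MvPowerSeries.coeff x.tail g) := coeff_joinFirst g x

theorem splitFirst_X_zero :
    splitFirst R l (MvPowerSeries.X 0) = MvPowerSeries.C PowerSeries.X := by
  classical
  ext d k
  rw [coeff_coeff_splitFirst, MvPowerSeries.coeff_X, MvPowerSeries.coeff_C]
  simp only [Finsupp.cons_eq_single_zero_iff]
  by_cases hd : d = 0 <;> simp [hd, PowerSeries.coeff_X]

theorem splitFirst_X_succ (i : Fin l) :
    splitFirst R l (MvPowerSeries.X i.succ) = MvPowerSeries.X i := by
  classical
  ext d k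
  rw [coeff_coeff_splitFirst, MvPowerSeries.coeff_X, MvPowerSeries.coeff_X]
  simp only [Finsupp.cons_eq_single_succ_iff]
  by_cases hd : d = Finsupp.single i 1 <;> simp [hd, PowerSeries.coeff_one]

end SplitFirst

section Topology

open Finset PowerSeries

variable {σ R : Type*} [TopologicalSpace R]

instance [CommSemiring R] [IsTopologicalSemiring R] :
    IsTopologicalSemiring (MvPowerSeries σ R) :=
  MvPowerSeries.WithPiTopology.instIsTopologicalSemiring σ R

instance [T2Space R] : T2Space (MvPowerSeries σ R) :=
  MvPowerSeries.WithPiTopology.instT2Space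

theorem MvPowerSeries.tendsto_of_coeff [Semiring R] {ι : Type*} {f : ι → MvPowerSeries σ R}
    {u : Filter ι} {g : MvPowerSeries σ R}
    (h : ∀ d, Filter.Tendsto (fun i => coeff d (f i)) u (nhds (coeff d g))) :
    Filter.Tendsto f u (nhds g) :=
  (MvPowerSeries.WithPiTopology.tendsto_iff_coeff_tendsto f u g).2 h

theorem MvPowerSeries.hasSum_of_coeff [Semiring R] {ι : Type*} {f : ι → MvPowerSeries σ R}
    {g : MvPowerSeries σ R} (h : ∀ d, HasSum (fun i => coeff d (f i)) (coeff d g)) :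
    HasSum f g :=
  MvPowerSeries.WithPiTopology.hasSum_iff_hasSum_coeff.2 h

theorem MvPowerSeries.multipliable_inverse_one_sub [CommRing R] {a : ℕ → MvPowerSeries σ R}
    (h : ∀ n, (n + 1 : ℕ) ≤ (a n).order) : Multipliable fun n => Ring.inverse (1 - a n) := by
  have hu : ∀ n, IsUnit (1 - a n) := by
    intro n
    rw [MvPowerSeries.isUnit_iff_constantCoeff, map_sub, map_one]
    have : constantCoeff (a n) = 0 := by
      rw [← one_le_order_iff_constCoeff_eq_zero]
      exact le_trans (by simp) (h n)
    simp [this]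
  have h1 : (fun n => Ring.inverse (1 - a n)) = fun n => 1 + a n * Ring.inverse (1 - a n) := by
    funext n
    have := Ring.mul_inverse_cancel _ (hu n)
    linear_combination this
  rw [h1]
  refine MvPowerSeries.WithPiTopology.multipliable_one_add_of_tendsto_order_atTop_nhds_top
    (f := fun n => a n * Ring.inverse (1 - a n)) ?_
  simp_rw [ENat.tendsto_nhds_top_iff_natCast_lt, Filter.eventually_atTop]
  refine fun n => ⟨n, fun m hm => lt_of_lt_of_le ?_ le_order_mul⟩
  refine lt_of_lt_of_le ?_ le_self_add
  refine lt_of_lt_of_le ?_ (h m)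
  exact_mod_cast Nat.lt_succ_of_le hm

end Topology

namespace PowerSeries

open Finset

/-- The fraction field of `ℤ⟦q⟧`. -/
abbrev QField : Type := FractionRing ℤ⟦X⟧

/-- The element `q` of the fraction field of `ℤ⟦q⟧`. -/
noncomputable def qElt : QField := algebraMap ℤ⟦X⟧ QField X

theorem algebraMap_qField_injective : Function.Injective (algebraMap ℤ⟦X⟧ QField) :=
  IsFractionRing.injective _ _

theorem qElt_ne_zero : qElt ≠ 0 := by
  rw [qElt, Ne, map_eq_zero_iff _ algebraMap_qField_injective]
  exact X_ne_zero

theorem qElt_pow_ne_one (n : ℕ) : qElt ^ (n + 1) ≠ 1 := by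
  rw [qElt, ← map_pow, Ne, map_eq_one_iff _ algebraMap_qField_injective]
  intro h
  have := congrArg constantCoeff h
  simp at this

instance : CharZero QField := by
  have : CharZero ℤ⟦X⟧ :=
    charZero_of_injective_ringHom (f := (C : ℤ →+* ℤ⟦X⟧)) C_injective
  exact charZero_of_injective_algebraMap algebraMap_qField_injective

theorem isUnit_one_sub_X_pow (n : ℕ) : IsUnit (1 - X ^ (n + 1) : ℤ⟦X⟧) := by
  rw [PowerSeries.isUnit_iff_constantCoeff]
  simp

/-- The one-vertex generating function has coefficients in `ℤ⟦q⟧`. -/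
theorem exists_map_eq_vertexSum :
    ∃ Z : ℤ⟦X⟧⟦X⟧, PowerSeries.map (algebraMap ℤ⟦X⟧ QField) Z = vertexSum qElt 0 := by
  have h : ∀ n, ∃ z : ℤ⟦X⟧, algebraMap ℤ⟦X⟧ QField z = coeff n (vertexSum qElt 0) := by
    intro n
    induction n with
    | zero => exact ⟨1, by simp [constantCoeff_vertexSum]⟩
    | succ n ih =>
      obtain ⟨z, hz⟩ := ih
      refine ⟨X * z * Ring.inverse (1 - X ^ (n + 1)), ?_⟩
      have h1 := congrArg (fun F => coeff (n + 1) ((1 - C qElt * X) * F))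
        (geo_mul_rescale_vertexSum_zero qElt_ne_zero qElt_pow_ne_one)
      simp only [← mul_assoc, one_sub_mul_geo, one_mul] at h1
      rw [sub_mul, one_mul, map_sub, mul_assoc, coeff_C_mul, coeff_succ_X_mul, coeff_rescale] at h1
      have h2 := congrArg (algebraMap ℤ⟦X⟧ QField)
        (Ring.mul_inverse_cancel _ (isUnit_one_sub_X_pow n))
      rw [map_mul, map_sub, map_one, map_pow] at h2
      change (1 - qElt ^ (n + 1)) * _ = 1 at h2
      have h3 : (1 - qElt ^ (n + 1)) ≠ 0 := sub_ne_zero.2 (qElt_pow_ne_one n).symm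
      rw [map_mul, map_mul, hz]
      change qElt * _ * _ = _
      refine mul_left_cancel₀ h3 ?_
      linear_combination qElt * coeff n (vertexSum qElt 0) * h2 + h1
  choose z hz using h
  exact ⟨PowerSeries.mk z, by ext n; simp [hz]⟩

/-- The integral form of the one-vertex generating function. -/
noncomputable def vertexSeries : ℤ⟦X⟧⟦X⟧ := exists_map_eq_vertexSum.choose

theorem map_vertexSeries :
    PowerSeries.map (algebraMap ℤ⟦X⟧ QField) vertexSeries = vertexSum qElt 0 :=
  exists_map_eq_vertexSum.choose_spec

theorem constantCoeff_vertexSeries : constantCoeff vertexSeries = 1 := by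
  apply algebraMap_qField_injective
  rw [map_one, ← constantCoeff_vertexSum qElt 0, ← map_vertexSeries]
  simp only [← coeff_zero_eq_constantCoeff_apply, coeff_map]

theorem one_sub_mul_vertexSeries :
    (1 - C X * X) * vertexSeries = rescale (X : ℤ⟦X⟧) vertexSeries := by
  have hinj : Function.Injective (PowerSeries.map (algebraMap ℤ⟦X⟧ QField)) :=
    PowerSeries.map_injective _ algebraMap_qField_injective
  apply hinj
  have h : PowerSeries.map (algebraMap ℤ⟦X⟧ QField) (rescale (X : ℤ⟦X⟧) vertexSeries) =
      rescale qElt (PowerSeries.map (algebraMap ℤ⟦X⟧ QField) vertexSeries) := by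
    ext n
    simp [coeff_rescale, qElt]
  rw [h, map_mul, map_vertexSeries, map_sub, map_one, map_mul, PowerSeries.map_C, PowerSeries.map_X]
  change (1 - C qElt * X) * _ = _
  have h1 := geo_mul_rescale_vertexSum_zero qElt_ne_zero qElt_pow_ne_one
  have h2 := one_sub_mul_geo qElt
  linear_combination (-(1 - C qElt * X)) * h1 + rescale qElt (vertexSum qElt 0) * h2

theorem one_sub_mul_rescale_vertexSeries (N : ℕ) :
    (1 - C (X ^ (N + 1)) * X) * rescale (X ^ N : ℤ⟦X⟧) vertexSeries =
      rescale (X ^ (N + 1) : ℤ⟦X⟧) vertexSeries := by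
  have h := congrArg (rescale (X ^ N : ℤ⟦X⟧)) one_sub_mul_vertexSeries
  rw [rescale_rescale, ← pow_succ', map_mul, map_sub, map_one, map_mul, rescale_X] at h
  have h1 : rescale (X ^ N : ℤ⟦X⟧) (C (X : ℤ⟦X⟧)) = C X := by
    ext n : 1
    rw [coeff_rescale, coeff_C]
    split_ifs with hn
    · rw [hn, pow_zero, one_mul]
    · rw [mul_zero]
  rw [← h, pow_succ', map_mul, h1, mul_assoc]

theorem substMonomial_one_sub {S : Type*} [CommRing S] {σ : Type*} {α : σ →₀ ℕ} (hα : α ≠ 0)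
    (a : S) : substMonomial α (1 - C a * X) =
      1 - MvPowerSeries.C a * MvPowerSeries.monomial α 1 := by
  have hs := PowerSeries.HasSubst.monomial hα (1 : S)
  rw [substMonomial, ← coe_substAlgHom hs, map_sub, map_one, map_mul, coe_substAlgHom hs,
    subst_X hs, subst_C]

variable {l : ℕ}

/-- The series `∏_{n > N} (1 - qⁿ y^α)⁻¹`. -/
noncomputable def rootSeries (α : Fin l →₀ ℕ) (N : ℕ) : MvPowerSeries (Fin (l + 1)) ℤ :=
  (splitFirst ℤ l).symm (substMonomial α (rescale (X ^ N : ℤ⟦X⟧) vertexSeries))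

theorem one_sub_mul_rootSeries {α : Fin l →₀ ℕ} (hα : α ≠ 0) {u : MvPowerSeries (Fin (l + 1)) ℤ}
    (hu : splitFirst ℤ l u = MvPowerSeries.monomial α 1) (N : ℕ) :
    (1 - MvPowerSeries.X 0 ^ (N + 1) * u) * rootSeries α N = rootSeries α (N + 1) := by
  apply (splitFirst ℤ l).injective
  rw [map_mul, map_sub, map_one, map_mul, map_pow, hu, splitFirst_X_zero, rootSeries, rootSeries,
    RingEquiv.apply_symm_apply, RingEquiv.apply_symm_apply, ← one_sub_mul_rescale_vertexSeries,
    substMonomial_mul hα, substMonomial_one_sub hα, map_pow]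

theorem coeff_rootSeries {α : Fin l →₀ ℕ} (hα : α ≠ 0) {x : Fin (l + 1) →₀ ℕ} {N : ℕ}
    (hN : x 0 < N) : MvPowerSeries.coeff x (rootSeries α N) = MvPowerSeries.coeff x 1 := by
  have h1 : (1 : MvPowerSeries (Fin (l + 1)) ℤ) =
      (splitFirst ℤ l).symm (substMonomial α 1) := by
    rw [substMonomial_one hα, map_one]
  rw [h1, rootSeries, coeff_splitFirst_symm, coeff_splitFirst_symm]
  by_cases h : ∃ n : ℕ, x.tail = n • α
  · obtain ⟨n, hn⟩ := h
    rw [hn, coeff_nsmul_substMonomial hα, coeff_nsmul_substMonomial hα]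
    cases n with
    | zero => simp [constantCoeff_vertexSeries]
    | succ n =>
      rw [coeff_rescale, ← pow_mul, coeff_X_pow_mul', if_neg, coeff_one,
        if_neg (by omega), map_zero]
      nlinarith
  · push Not at h
    rw [coeff_substMonomial_eq_zero hα _ h, coeff_substMonomial_eq_zero hα _ h]

theorem tprod_eq_rootSeries {α : Fin l →₀ ℕ} (hα : α ≠ 0) {u : MvPowerSeries (Fin (l + 1)) ℤ}
    (hu : splitFirst ℤ l u = MvPowerSeries.monomial α 1) :
    ∏' n : ℕ, Ring.inverse (1 - MvPowerSeries.X 0 ^ (n + 1) * u) = rootSeries α 0 := by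
  have hord : ∀ n : ℕ, ((n + 1 : ℕ) : ℕ∞) ≤ (MvPowerSeries.X 0 ^ (n + 1) * u).order := by
    intro n
    refine le_trans ?_ MvPowerSeries.le_order_mul
    refine le_trans ?_ le_self_add
    exact MvPowerSeries.le_order_pow_of_constantCoeff_eq_zero _ (by simp)
  have hu' : ∀ n : ℕ, IsUnit (1 - MvPowerSeries.X 0 ^ (n + 1) * u) := by
    intro n
    rw [MvPowerSeries.isUnit_iff_constantCoeff]
    simp
  have hlim := (MvPowerSeries.multipliable_inverse_one_sub hord).hasProd.tendsto_prod_nat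
  have hroot : Filter.Tendsto (rootSeries α) Filter.atTop (nhds 1) := by
    refine MvPowerSeries.tendsto_of_coeff fun x => tendsto_const_nhds.congr' ?_
    filter_upwards [Filter.eventually_gt_atTop (x 0)] with N hN
    exact (coeff_rootSeries hα hN).symm
  have hmul := hlim.mul hroot
  rw [mul_one] at hmul
  refine tendsto_nhds_unique hmul (tendsto_const_nhds.congr fun N => ?_)
  induction N with
  | zero => simp
  | succ N ih =>
    rw [prod_range_succ, ← one_sub_mul_rootSeries hα hu, mul_assoc, ← mul_assoc (Ring.inverse _),
      Ring.inverse_mul_cancel _ (hu' N), one_mul]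
    exact ih

end PowerSeries

section Transfer

open Finset PowerSeries

variable {l : ℕ}

/-- The embedding of `ℤ⟦q, y₁, …, y_l⟧` into power series in `y₁, …, y_l` over a field. -/
noncomputable def toField (l : ℕ) :
    MvPowerSeries (Fin (l + 1)) ℤ →+* MvPowerSeries (Fin l) QField :=
  (MvPowerSeries.map (algebraMap (PowerSeries ℤ) QField)).comp (splitFirst ℤ l : _ →+* _)

theorem toField_apply (f : MvPowerSeries (Fin (l + 1)) ℤ) : toField l f =
    MvPowerSeries.map (algebraMap (PowerSeries ℤ) QField) (splitFirst ℤ l f) := rfl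

theorem toField_injective : Function.Injective (toField l) := by
  intro f g h
  refine (splitFirst ℤ l).injective (MvPowerSeries.ext fun d => algebraMap_qField_injective ?_)
  have := congrArg (MvPowerSeries.coeff d) h
  simpa [toField_apply] using this

theorem splitFirst_Q : splitFirst ℤ l (Q l) = MvPowerSeries.C PowerSeries.X :=
  splitFirst_X_zero

theorem splitFirst_Y (i : Fin l) : splitFirst ℤ l (Y l (i + 1)) = MvPowerSeries.X i := by
  have : (i : ℕ) + 1 < l + 1 := by omega
  rw [Y, dif_pos this]
  exact splitFirst_X_succ i

theorem toField_Q : toField l (Q l) = MvPowerSeries.C qElt := by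
  rw [toField_apply, splitFirst_Q, MvPowerSeries.map_C]
  rfl

theorem splitFirst_prod_Y (c : ℕ → ℕ) :
    splitFirst ℤ l (∏ s ∈ Icc 1 l, Y l s ^ c s) = MvPowerSeries.monomial (resD l c) 1 := by
  rw [prod_Icc_eq_prod_fin, map_prod, MvPowerSeries.monomial_one_eq,
    Finsupp.prod_fintype _ _ (fun i => pow_zero _)]
  refine prod_congr rfl fun i _ => ?_
  rw [map_pow, splitFirst_Y, resD_apply]

theorem toField_prod_Y (c : ℕ → ℕ) :
    toField l (∏ s ∈ Icc 1 l, Y l s ^ c s) = MvPowerSeries.monomial (resD l c) 1 := by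
  rw [toField_apply, splitFirst_prod_Y, MvPowerSeries.map_monomial, map_one]

theorem toField_rootSeries {α : Fin l →₀ ℕ} (hα : α ≠ 0) :
    toField l (rootSeries α 0) = substMonomial α (vertexSum qElt 0) := by
  rw [toField_apply, rootSeries, RingEquiv.apply_symm_apply, pow_zero, PowerSeries.rescale_one,
    RingHom.id_apply, ← map_vertexSeries]
  ext d
  rw [MvPowerSeries.coeff_map]
  by_cases h : ∃ n : ℕ, d = n • α
  · obtain ⟨n, rfl⟩ := h
    rw [coeff_nsmul_substMonomial hα, coeff_nsmul_substMonomial hα, PowerSeries.coeff_map]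
  · push Not at h
    rw [coeff_substMonomial_eq_zero hα _ h, coeff_substMonomial_eq_zero hα _ h, map_zero]

theorem isUnit_qPoch (m : ℕ) : IsUnit (qPoch l m) := by
  rw [MvPowerSeries.isUnit_iff_constantCoeff, qPoch, map_prod]
  simp [Q]

theorem toField_inverse_qPoch (m : ℕ) :
    toField l (Ring.inverse (qPoch l m)) = MvPowerSeries.C (qp qElt m)⁻¹ := by
  have h1 : toField l (qPoch l m) = MvPowerSeries.C (qp qElt m) := by
    simp only [qPoch, qp, map_prod, map_sub, map_one, map_pow, toField_Q]
  have h2 := congrArg (toField l) (Ring.mul_inverse_cancel _ (isUnit_qPoch (l := l) m))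
  rw [map_mul, map_one, h1] at h2
  have h3 : MvPowerSeries.C (σ := Fin l) (qp qElt m)⁻¹ * MvPowerSeries.C (qp qElt m) = 1 := by
    rw [← map_mul, inv_mul_cancel₀ (qp_ne_zero qElt_pow_ne_one m), map_one]
  linear_combination MvPowerSeries.C (σ := Fin l) (qp qElt m)⁻¹ * h2 -
    toField l (Ring.inverse (qPoch l m)) * h3

theorem toField_finprod_inverse_qPoch (r : ℕ → ℕ) :
    toField l (∏ᶠ j, Ring.inverse (qPoch l (r j - r (j + 1)))) =
      MvPowerSeries.C (stepWeight qElt r) := by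
  have h1 : toField l (∏ᶠ j, Ring.inverse (qPoch l (r j - r (j + 1)))) =
      ∏ᶠ j, toField l (Ring.inverse (qPoch l (r j - r (j + 1)))) :=
    MonoidHom.map_finprod_of_injective (toField l).toMonoidHom toField_injective _
  have h2 : MvPowerSeries.C (σ := Fin l) (∏ᶠ j, (qp qElt (r j - r (j + 1)))⁻¹) =
      ∏ᶠ j, MvPowerSeries.C (qp qElt (r j - r (j + 1)))⁻¹ :=
    MonoidHom.map_finprod_of_injective (MvPowerSeries.C (σ := Fin l) (R := QField)).toMonoidHom
      MvPowerSeries.C_injective _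
  rw [h1, stepWeight, h2]
  exact finprod_congr fun j => toField_inverse_qPoch _

/-- The exponent as a sum of values of the quadratic form. -/
theorem finsum_formD {r : ℕ → ℕ → ℕ} (hr : ∀ i, IsDescending (r i)) (l : ℕ) :
    ∑ᶠ t, formD l (fun s => (r s t : ℤ)) =
      (∑ i ∈ Icc 1 l, ∑ᶠ t : ℕ, (r i t : ℤ) ^ 2)
        - (∑ i ∈ Icc 2 (l - 1), ∑ᶠ t : ℕ, (r (i - 1) t : ℤ) * (r i t : ℤ))
        - ∑ᶠ t : ℕ, (r (l - 2) t : ℤ) * (r l t : ℤ) := by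
  choose N hN using fun i => (hr i).2
  have h0 : ∀ i ≤ l, ∀ t, (∑ i ∈ range (l + 1), N i) ≤ t → r i t = 0 := fun i hi t ht =>
    hN i t (le_trans (single_le_sum (f := N) (fun _ _ => Nat.zero_le _)
      (mem_range.2 (Nat.lt_succ_of_le hi))) ht)
  generalize (∑ i ∈ range (l + 1), N i) = M at h0
  have hfin : ∀ f : ℕ → ℤ, (∀ t, M ≤ t → f t = 0) → ∑ᶠ t, f t = ∑ t ∈ range M, f t := by
    intro f hf
    refine finsum_eq_sum_of_support_subset _ fun t ht => ?_
    rw [coe_range, Set.mem_Iio]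
    by_contra hc
    exact ht (hf t (not_lt.1 hc))
  rw [sum_congr rfl fun i hi => hfin (fun t => (r i t : ℤ) ^ 2) fun t ht => by
      simp [h0 i (mem_Icc.1 hi).2 t ht],
    sum_congr (s₁ := Icc 2 (l - 1)) rfl fun i hi =>
      hfin (fun t => (r (i - 1) t : ℤ) * (r i t : ℤ)) fun t ht => by
        have := (mem_Icc.1 hi).2
        simp [h0 i (by omega) t ht],
    hfin (fun t => (r (l - 2) t : ℤ) * (r l t : ℤ)) fun t ht => by simp [h0 l le_rfl t ht],
    hfin (fun t => formD l fun s => (r s t : ℤ)), sum_comm, sum_comm (s := Icc 2 (l - 1)),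
    ← sum_sub_distrib, ← sum_sub_distrib]
  · rfl
  · intro t ht
    rw [formD, h0 l le_rfl t ht, sum_eq_zero, sum_eq_zero]
    · simp
    · intro i hi
      have := (mem_Icc.1 hi).2
      simp [h0 i (by omega) t ht]
    · intro i hi
      simp [h0 i (mem_Icc.1 hi).2 t ht]

theorem finsum_formD_nonneg (hl : 3 ≤ l) (r : ℕ → ℕ → ℕ) :
    0 ≤ ∑ᶠ t, formD l (fun s => (r s t : ℤ)) :=
  finsum_nonneg fun _ => formD_nonneg hl _

/-- The summand attached to a tuple of descending sequences. -/
noncomputable def tupleTerm (l : ℕ) (r : ℕ → ℕ → ℕ) : MvPowerSeries (Fin (l + 1)) ℤ :=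
  Q l ^ (∑ᶠ t, formD l (fun s => (r s t : ℤ))).toNat
    * (∏ i ∈ Icc 1 l, Y l i ^ (∑ᶠ t : ℕ, r i t))
    * ∏ i ∈ Icc 1 l, ∏ᶠ j : ℕ, Ring.inverse (qPoch l (r i j - r i (j + 1)))

theorem toField_tupleTerm (hl : 3 ≤ l) (ρ : Fin l → ℕ → ℕ) :
    toField l (tupleTerm l (extD ρ)) =
      MvPowerSeries.monomial (Finsupp.equivFunOnFinite.symm fun i => ∑ᶠ t, ρ i t)
        (tupleWeight qElt (fun v : Fin l → ℤ => formD l (extD v)) ρ) := by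
  have h1 : ∀ t, (fun s => ((extD ρ s t : ℕ) : ℤ)) = extD fun i => (ρ i t : ℤ) := by
    intro t
    funext s
    by_cases hs : s ∈ Icc 1 l
    · obtain ⟨i, rfl⟩ := exists_val_succ_eq hs
      simp
    · rw [extD_of_notMem _ hs, extD_of_notMem _ hs]
      simp
  have h2 : resD l (fun i => ∑ᶠ t, extD ρ i t) =
      Finsupp.equivFunOnFinite.symm fun i => ∑ᶠ t, ρ i t := by
    ext i
    simp
  rw [tupleTerm, map_mul, map_mul, map_pow, toField_Q, toField_prod_Y, h2, map_prod,
    prod_Icc_eq_prod_fin]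
  simp only [toField_finprod_inverse_qPoch, extD_val_succ]
  rw [tupleWeight, ← map_pow, ← map_prod]
  have h3 : qElt ^ (∑ᶠ t, formD l (fun s => ((extD ρ s t : ℕ) : ℤ))).toNat =
      qElt ^ (∑ᶠ t, formD l (extD fun i => (ρ i t : ℤ))) := by
    rw [← zpow_natCast, Int.toNat_of_nonneg (finsum_formD_nonneg hl _)]
    simp only [h1]
  rw [h3]
  ext d
  rw [mul_comm, MvPowerSeries.coeff_C_mul, MvPowerSeries.coeff_C_mul]
  classical
  rw [MvPowerSeries.coeff_monomial, MvPowerSeries.coeff_monomial]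
  split_ifs <;> ring

theorem coeff_tupleTerm_eq_zero (hl : 3 ≤ l) (ρ : Fin l → ℕ → ℕ) {x : Fin (l + 1) →₀ ℕ}
    (h : ¬ ∀ i, ∑ᶠ t, ρ i t = x.tail i) :
    MvPowerSeries.coeff x (tupleTerm l (extD ρ)) = 0 := by
  classical
  have h1 : MvPowerSeries.coeff x.tail (splitFirst ℤ l (tupleTerm l (extD ρ))) = 0 := by
    apply algebraMap_qField_injective
    rw [← MvPowerSeries.coeff_map, ← toField_apply, toField_tupleTerm hl,
      MvPowerSeries.coeff_monomial, if_neg, map_zero]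
    intro hx
    exact h fun i => by rw [hx]; rfl
  rw [← Finsupp.cons_tail x, ← coeff_coeff_splitFirst, h1, map_zero]

theorem coeff_eq_sum_tupleTerm (hl : 3 ≤ l) {F : MvPowerSeries (Fin (l + 1)) ℤ}
    (hF : toField l F = quiverSum qElt (fun v : Fin l → ℤ => formD l (extD v)))
    (x : Fin (l + 1) →₀ ℕ) : MvPowerSeries.coeff x F =
      ∑ ρ ∈ Fintype.piFinset (fun i => descending (x.tail i)),
        MvPowerSeries.coeff x (tupleTerm l (extD ρ)) := by
  classical
  have h1 : MvPowerSeries.coeff x.tail (splitFirst ℤ l F) =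
      ∑ ρ ∈ Fintype.piFinset (fun i => descending (x.tail i)),
        MvPowerSeries.coeff x.tail (splitFirst ℤ l (tupleTerm l (extD ρ))) := by
    apply algebraMap_qField_injective
    rw [map_sum, ← MvPowerSeries.coeff_map, ← toField_apply, hF, coeff_quiverSum]
    refine sum_congr rfl fun ρ hρ => ?_
    rw [← MvPowerSeries.coeff_map, ← toField_apply, toField_tupleTerm hl,
      MvPowerSeries.coeff_monomial, if_pos]
    ext i
    exact ((mem_descending.1 (Fintype.mem_piFinset.1 hρ i)).2).symm
  rw [← Finsupp.cons_tail x, ← coeff_coeff_splitFirst, h1, map_sum]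
  refine sum_congr (by simp) fun ρ _ => ?_
  rw [coeff_coeff_splitFirst]

theorem hasSum_tupleTerm (hl : 3 ≤ l) {F : MvPowerSeries (Fin (l + 1)) ℤ}
    (hF : toField l F = quiverSum qElt (fun v : Fin l → ℤ => formD l (extD v))) :
    HasSum (fun r : {r : ℕ → ℕ → ℕ //
      (∀ i, IsDescending (r i)) ∧ ∀ i, i ∉ Icc 1 l → r i = 0} => tupleTerm l r.1) F := by
  classical
  refine MvPowerSeries.hasSum_of_coeff fun x => ?_
  have hext : ∀ r : {r : ℕ → ℕ → ℕ // (∀ i, IsDescending (r i)) ∧ ∀ i, i ∉ Icc 1 l → r i = 0},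
      extD (fun i : Fin l => r.1 (i + 1)) = r.1 := fun r => extD_restrict r.2.2
  set g : {r : ℕ → ℕ → ℕ // (∀ i, IsDescending (r i)) ∧ ∀ i, i ∉ Icc 1 l → r i = 0} →
    (Fin l → ℕ → ℕ) := fun r i => r.1 (i + 1) with hg
  set f : (Fin l → ℕ → ℕ) → ℤ := fun ρ => if ∀ i, IsDescending (ρ i) then
    MvPowerSeries.coeff x (tupleTerm l (extD ρ)) else 0 with hf
  have hinj : Function.Injective g := fun r r' h =>
    Subtype.ext (by rw [← hext r, ← hext r']; exact congrArg extD h)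
  have hfg : (fun r : {r : ℕ → ℕ → ℕ //
      (∀ i, IsDescending (r i)) ∧ ∀ i, i ∉ Icc 1 l → r i = 0} =>
      MvPowerSeries.coeff x (tupleTerm l r.1)) = f ∘ g := by
    funext r
    rw [Function.comp_apply, hf]
    simp only
    rw [if_pos fun i => r.2.1 _, hg, hext]
  rw [hfg, hinj.hasSum_iff]
  · have h1 : MvPowerSeries.coeff x F =
        ∑ ρ ∈ Fintype.piFinset (fun i => descending (x.tail i)), f ρ := by
      rw [coeff_eq_sum_tupleTerm hl hF]
      refine sum_congr rfl fun ρ hρ => (if_pos fun i => ?_).symm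
      exact (mem_descending.1 (Fintype.mem_piFinset.1 hρ i)).1
    rw [h1]
    refine hasSum_sum_of_ne_finset_zero fun ρ hρ => ?_
    by_cases hd : ∀ i, IsDescending (ρ i)
    · rw [hf]
      simp only
      rw [if_pos hd]
      refine coeff_tupleTerm_eq_zero hl ρ fun h => hρ ?_
      exact Fintype.mem_piFinset.2 fun i => mem_descending.2 ⟨hd i, h i⟩
    · exact if_neg hd
  · intro ρ hρ
    refine if_neg fun hd => hρ ⟨⟨extD ρ, fun s => ?_, fun s hs => extD_of_notMem _ hs⟩, ?_⟩
    · by_cases hs : s ∈ Icc 1 l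
      · obtain ⟨i, rfl⟩ := exists_val_succ_eq hs
        rw [extD_val_succ]
        exact hd i
      · rw [extD_of_notMem _ hs]
        exact IsDescending.zero
    · funext i
      simp [hg]

end Transfer

/-- The identity of Theorem 7.3 in type `D_l` (`l ≥ 3`), where the Dynkin
diagram is the chain `α₁ – α₂ – ⋯ – α_{l-1}` with the node `α_l` attached to `α_{l-2}`.
Positive roots (vectors `c : ℕ → ℕ` supported on `1 ≤ s ≤ l`):
`αᵢ + ⋯ + α_j` for `1 ≤ i ≤ j ≤ l-1`; `αᵢ + ⋯ + α_{l-2} + α_l` for `1 ≤ i ≤ l-2`,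
together with `α_l`; and
`αᵢ + ⋯ + α_{j-1} + 2(α_j + ⋯ + α_{l-2}) + α_{l-1} + α_l` for `1 ≤ i < j ≤ l-1`.
Then in `ℤ[[q, y₁, …, y_l]]`:
`∏_{c ∈ Φ⁺} ∏_{n ≥ 1} (1 - qⁿ y^c)⁻¹
  = ∑_{(r₁,…,r_l) descending} q^{E r} (∏ᵢ yᵢ^{|rᵢ|}) ∏ᵢ ∏_{j ≥ 1} (q;q)_{rᵢ^{(j)}-rᵢ^{(j+1)}}⁻¹`,
with `E r = ∑_{i=1}^{l} ∑_{t≥1} (rᵢ^{(t)})² - ∑_{i=2}^{l-1} ∑_{t≥1} r_{i-1}^{(t)} rᵢ^{(t)}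
 - ∑_{t≥1} r_{l-2}^{(t)} r_l^{(t)}`, a nonnegative integer. -/
theorem stmt_8 (l : ℕ) (hl : 3 ≤ l)
    (Φ : Finset (ℕ → ℕ))
    (hΦ : ∀ c : ℕ → ℕ, c ∈ Φ ↔
      ((∃ i j, 1 ≤ i ∧ i ≤ j ∧ j ≤ l - 1 ∧
          c = fun s => if i ≤ s ∧ s ≤ j then 1 else 0)
        ∨ (∃ i, 1 ≤ i ∧ i ≤ l - 2 ∧
          c = fun s => (if i ≤ s ∧ s ≤ l - 2 then 1 else 0) + (if s = l then 1 else 0))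
        ∨ (c = fun s => if s = l then 1 else 0)
        ∨ (∃ i j, 1 ≤ i ∧ i < j ∧ j ≤ l - 1 ∧
          c = fun s => (if i ≤ s ∧ s ≤ j - 1 then 1 else 0)
            + (if j ≤ s ∧ s ≤ l - 2 then 2 else 0)
            + (if s = l - 1 ∨ s = l then 1 else 0))))
    (E : (ℕ → ℕ → ℕ) → ℤ)
    (hE : ∀ r : ℕ → ℕ → ℕ, E r =
      (∑ i ∈ Finset.Icc 1 l, ∑ᶠ t : ℕ, (r i t : ℤ) ^ 2)
        - (∑ i ∈ Finset.Icc 2 (l - 1), ∑ᶠ t : ℕ, (r (i - 1) t : ℤ) * (r i t : ℤ))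
        - ∑ᶠ t : ℕ, (r (l - 2) t : ℤ) * (r l t : ℤ)) :
    (∀ r : ℕ → ℕ → ℕ,
        (∀ i, IsDescending (r i)) → (∀ i, i ∉ Finset.Icc 1 l → r i = 0) → 0 ≤ E r)
    ∧ (∏ c ∈ Φ, ∏' n : ℕ,
          Ring.inverse (1 - Q l ^ (n + 1) * ∏ s ∈ Finset.Icc 1 l, Y l s ^ c s))
      = ∑' r : {r : ℕ → ℕ → ℕ //
            (∀ i, IsDescending (r i)) ∧ ∀ i, i ∉ Finset.Icc 1 l → r i = 0},
          Q l ^ (E r.1).toNat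
            * (∏ i ∈ Finset.Icc 1 l, Y l i ^ (∑ᶠ t : ℕ, r.1 i t))
            * ∏ i ∈ Finset.Icc 1 l, ∏ᶠ j : ℕ,
                Ring.inverse (qPoch l (r.1 i j - r.1 i (j + 1))) := by
  have hroot : ∀ c, c ∈ Φ ↔ IsRootD l c := hΦ
  refine ⟨fun r hr _ => ?_, ?_⟩
  · rw [hE, ← finsum_formD hr l]
    exact finsum_formD_nonneg hl r
  have hprod : (∏ c ∈ Φ, ∏' n : ℕ,
      Ring.inverse (1 - Q l ^ (n + 1) * ∏ s ∈ Finset.Icc 1 l, Y l s ^ c s)) =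
      ∏ c ∈ Φ, PowerSeries.rootSeries (resD l c) 0 :=
    Finset.prod_congr rfl fun c hc =>
      PowerSeries.tprod_eq_rootSeries (resD_ne_zero hl ((hroot c).1 hc)) (splitFirst_prod_Y c)
  have hfield : toField l (∏ c ∈ Φ, PowerSeries.rootSeries (resD l c) 0) =
      quiverSum PowerSeries.qElt (fun v : Fin l → ℤ => formD l (extD v)) := by
    rw [map_prod, quiverSum_formD PowerSeries.qElt_ne_zero PowerSeries.qElt_pow_ne_one hl hroot]
    exact Finset.prod_congr rfl fun c hc =>
      toField_rootSeries (resD_ne_zero hl ((hroot c).1 hc))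
  rw [hprod, ← (hasSum_tupleTerm hl hfield).tsum_eq]
  refine tsum_congr fun r => ?_
  rw [tupleTerm, finsum_formD r.2.1 l, ← hE]
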